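/- Let P and Q be polynomials on ℂⁿ with Q not identically zero, and let p be a point of a compact subanalytic set K ⊂ ℂⁿ. Then the rational function P/Q, defined on U = {Q ≠ 0}, has polynomial growth at p: there exist a compact neighbourhood K' ⊂ K of p, a constant C > 0 and N ∈ ℕ such that |P(x)/Q(x)| ≤ C · dist(x, K' \ U)^{-N} for all x ∈ K' ∩ U. -/

import Mathlib

open scoped Topology
open Set

/-- A subset of a real normed space is *semianalytic* if, locally, it is a finite union of
finite intersections of zero sets and positivity sets of real-analytic functions. -/
def Semianalytic {E : Type*} [NormedAddCommGroup E] [NormedSpace ℝ E] (A : Set E) : Prop :=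
  ∀ x : E, ∃ U ∈ 𝓝 x, ∃ (p q : ℕ) (f g : Fin p → Fin q → E → ℝ),
    (∀ i j, AnalyticOnNhd ℝ (f i j) U) ∧ (∀ i j, AnalyticOnNhd ℝ (g i j) U) ∧
    A ∩ U = (⋃ i, ⋂ j, {y | f i j y = 0} ∩ {y | 0 < g i j y}) ∩ U

/-- A subset of a real normed space is *subanalytic* if, locally, it is the projection of a
relatively compact semianalytic subset of a product with some `ℝ^m`. -/
def Subanalytic {E : Type*} [NormedAddCommGroup E] [NormedSpace ℝ E] (A : Set E) : Prop :=
  ∀ x : E, ∃ U ∈ 𝓝 x, ∃ (m : ℕ) (B : Set (E × (Fin m → ℝ))),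
    Semianalytic B ∧ IsCompact (closure B) ∧ A ∩ U = (Prod.fst '' B) ∩ U

open Filter


/-- The germs of real analytic functions form a domain. -/
lemma germ_mul_eq_zero {E : Type*} [NormedAddCommGroup E] [NormedSpace ℝ E] {f g : E → ℝ} {a : E}
    (hf : AnalyticAt ℝ f a) (hg : AnalyticAt ℝ g a) (h : ∀ᶠ x in 𝓝 a, f x * g x = 0) :
    (∀ᶠ x in 𝓝 a, f x = 0) ∨ (∀ᶠ x in 𝓝 a, g x = 0) := by
  obtain ⟨r, hr, hb⟩ := Metric.eventually_nhds_iff_ball.1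
    (hf.eventually_analyticAt.and (hg.eventually_analyticAt.and h))
  by_cases hz : ∀ x ∈ Metric.ball a r, f x = 0
  · left
    filter_upwards [Metric.ball_mem_nhds a hr] with x hx using hz x hx
  · right
    push Not at hz
    obtain ⟨x, hx, hfx⟩ := hz
    have hgan : AnalyticOnNhd ℝ g (Metric.ball a r) := fun y hy => (hb y hy).2.1
    have h0 : g =ᶠ[𝓝 x] 0 := by
      filter_upwards [(hb x hx).1.continuousAt.eventually_ne hfx,
        Metric.isOpen_ball.mem_nhds hx] with y hy1 hy2
      have := (hb y hy2).2.2
      simpa [hy1] using this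
    have := hgan.eqOn_zero_of_preconnected_of_eventuallyEq_zero
      (convex_ball a r).isPreconnected hx h0
    filter_upwards [Metric.ball_mem_nhds a hr] with y hy using this hy

lemma telescope_aux {E : Type*} [NormedAddCommGroup E] [NormedSpace ℝ E] (n : ℕ)
    (M : ContinuousMultilinearMap ℝ (fun _ : Fin (n+1) => E) ℝ) (x y e : E) (t : ℝ)
    (hx : x = y + t • e) :
    M (fun _ => x) - M (fun _ => y) =
      t * ∑ k : Fin (n+1), M (fun j => if j < k then x else if j = k then e else y) := by
  have key : ∀ k : Fin (n+1), t * M (fun j => if j < k then x else if j = k then e else y) =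
      M (fun j => if (j:ℕ) < (k:ℕ) + 1 then x else y) - M (fun j => if (j:ℕ) < (k:ℕ) then x else y) := by
    intro k
    have e1 : (fun j : Fin (n+1) => if (j:ℕ) < (k:ℕ) + 1 then x else y) =
        Function.update (fun j : Fin (n+1) => if (j:ℕ) < (k:ℕ) then x else y) k (y + t • e) := by
      funext j
      by_cases hj : j = k
      · subst hj; simp [hx]
      · have : (j:ℕ) ≠ k := fun h => hj (Fin.ext h)
        have h2 : ((j:ℕ) < (k:ℕ) + 1) ↔ (j:ℕ) < k := by omega
        simp [Function.update_of_ne hj, h2]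
    have e2 : (fun j : Fin (n+1) => if j < k then x else if j = k then e else y) =
        Function.update (fun j : Fin (n+1) => if (j:ℕ) < (k:ℕ) then x else y) k e := by
      funext j
      by_cases hj : j = k
      · subst hj; simp
      · simp [hj]
    have e3 : (fun j : Fin (n+1) => if (j:ℕ) < (k:ℕ) then x else y) =
        Function.update (fun j : Fin (n+1) => if (j:ℕ) < (k:ℕ) then x else y) k y := by
      funext j
      by_cases hj : j = k
      · subst hj; simp
      · simp [Function.update_of_ne hj]
    rw [e1, e2, M.map_update_add, M.map_update_smul]
    nth_rewrite 4 [e3]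
    simp
  rw [Finset.mul_sum, Finset.sum_congr rfl (fun k _ => key k)]
  rw [Fin.sum_univ_eq_sum_range (fun k => M (fun j : Fin (n+1) => if (j:ℕ) < k + 1 then x else y)
    - M (fun j : Fin (n+1) => if (j:ℕ) < k then x else y))]
  rw [Finset.sum_range_sub (fun k => M (fun j : Fin (n+1) => if (j:ℕ) < k then x else y))]
  have : ∀ j : Fin (n+1), (j : ℕ) < n + 1 := fun j => j.2
  simp only [this, if_true, Nat.not_lt_zero, if_false]

/-- Division of analytic germs by a coordinate. -/
lemma analytic_division {E : Type*} [NormedAddCommGroup E] [NormedSpace ℝ E]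
    (π : E →L[ℝ] E) (l : E →L[ℝ] ℝ) (e : E) (hπ : ∀ x, x = π x + l x • e) {f : E → ℝ}
    (hf : AnalyticAt ℝ f 0) :
    ∃ f1 : E → ℝ, AnalyticAt ℝ f1 0 ∧ ∀ᶠ x in 𝓝 0, f x = f (π x) + l x * f1 x := by
  obtain ⟨p, r, hp⟩ := hf
  let A : (n : ℕ) → Fin (n+1) → Fin (n+1) → (E →L[ℝ] E) := fun n k j =>
    if j ≤ k then ContinuousLinearMap.id ℝ E else π
  let q : FormalMultilinearSeries ℝ E ℝ := fun n => ∑ k : Fin (n+1),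
    (((p (n+1)).compContinuousLinearMap (A n k)).curryMid k e)
  have hq : ∀ n (x : E), q n (fun _ => x) =
      ∑ k : Fin (n+1), p (n+1) (fun j => if j < k then x else if j = k then e else π x) := by
    intro n x
    simp only [q, sum_apply]
    refine Finset.sum_congr rfl fun k _ => ?_
    rw [ContinuousMultilinearMap.curryMid_apply,
      ContinuousMultilinearMap.compContinuousLinearMap_apply]
    congr 1
    funext j
    rcases Fin.eq_self_or_eq_succAbove k j with h | ⟨i, h⟩
    · subst h; simp [A]
    · subst h
      have hne : k.succAbove i ≠ k := Fin.succAbove_ne k i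
      rw [Fin.insertNth_apply_succAbove]
      simp only [A, hne, if_false]
      by_cases h : k.succAbove i < k
      · simp [h, h.le]
      · have : ¬ k.succAbove i ≤ k := fun h' => h (lt_of_le_of_ne h' hne)
        simp [h, this]
  -- norm bound
  set C : ℝ := max 1 ‖π‖ with hC
  have hC1 : 1 ≤ C := le_max_left _ _
  have hA : ∀ n k j, ‖A n k j‖ ≤ C := by
    intro n k j
    simp only [A]
    split_ifs
    · exact ContinuousLinearMap.norm_id_le.trans hC1
    · exact le_max_right _ _
  have hbound : ∀ n, ‖q n‖ ≤ (n+1) * (‖p (n+1)‖ * C^(n+1) * ‖e‖) := by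
    intro n
    calc ‖q n‖ ≤ ∑ k : Fin (n+1), ‖((p (n+1)).compContinuousLinearMap (A n k)).curryMid k e‖ :=
          norm_sum_le _ _
      _ ≤ ∑ k : Fin (n+1), (‖p (n+1)‖ * C^(n+1) * ‖e‖) := by
          refine Finset.sum_le_sum fun k _ => ?_
          refine (ContinuousLinearMap.le_opNorm _ _).trans ?_
          rw [ContinuousMultilinearMap.norm_curryMid]
          gcongr
          refine (ContinuousMultilinearMap.norm_compContinuousLinearMap_le _ _).trans ?_
          gcongr
          calc ∏ j, ‖A n k j‖ ≤ ∏ j : Fin (n+1), C := by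
                gcongr with j; exact hA n k j
            _ = C^(n+1) := by simp
      _ = _ := by simp
  obtain ⟨s, hs0, hsr⟩ := ENNReal.lt_iff_exists_nnreal_btwn.1 (lt_of_lt_of_le hp.r_pos hp.r_le)
  have hs0' : 0 < (s:ℝ) := by simpa using hs0
  obtain ⟨D, hD0, hD⟩ := p.norm_mul_pow_le_of_lt_radius hsr
  let ρ : NNReal := ⟨s / (2 * C), by positivity⟩
  have hρ : (ρ:ℝ) = s / (2 * C) := rfl
  have hρ0 : 0 < (ρ:ℝ) := by rw [hρ]; positivity
  have hrad : (ρ : ENNReal) ≤ q.radius := by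
    refine q.le_radius_of_bound (‖e‖ * D * (2 * C / s)) fun n => ?_
    have h1 := hbound n
    have h2 : ((n:ℝ)+1) ≤ 2^(n+1) := by
      have := (Nat.lt_two_pow_self (n := n+1)).le
      exact_mod_cast this
    have h3 : C ^(n+1) * 2^(n+1) * (ρ:ℝ)^(n+1) = s^(n+1) := by
      rw [hρ, ← mul_pow, ← mul_pow]; congr 1; field_simp
    have h4 : (ρ:ℝ)^n = ρ^(n+1) * (2*C/s) := by
      rw [pow_succ, hρ]; field_simp
    calc ‖q n‖ * ρ^n ≤ ((n+1) * (‖p (n+1)‖ * C^(n+1) * ‖e‖)) * ρ^n := by gcongr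
      _ ≤ (2^(n+1) * (‖p (n+1)‖ * C^(n+1) * ‖e‖)) * ρ^n := by gcongr
      _ = ‖e‖ * (‖p (n+1)‖ * (C^(n+1) * 2^(n+1) * ρ^(n+1))) * (2*C/s) := by rw [h4]; ring
      _ = ‖e‖ * (‖p (n+1)‖ * s^(n+1)) * (2*C/s) := by rw [h3]
      _ ≤ ‖e‖ * D * (2*C/s) := by gcongr; exact hD (n+1)
  have hrad0 : 0 < q.radius := lt_of_lt_of_le (by exact_mod_cast hρ0) hrad
  have hqs := q.hasFPowerSeriesOnBall hrad0
  refine ⟨q.sum, ⟨q, _, hqs⟩, ?_⟩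
  have hπ0 : Tendsto π (𝓝 0) (𝓝 0) := by
    have := π.continuous.tendsto 0
    simpa using this
  filter_upwards [Metric.eball_mem_nhds (0:E) hrad0, Metric.eball_mem_nhds (0:E) hp.r_pos,
    hπ0 (Metric.eball_mem_nhds (0:E) hp.r_pos)] with x hx1 hx2 hx3
  have s1 := hqs.hasSum hx1
  have s2 := hp.hasSum hx2
  have s3 := hp.hasSum hx3
  simp only [zero_add] at s1 s2 s3
  have s4 := s2.sub s3
  have s5 : HasSum (fun n => l x * q n (fun _ => x)) (l x * q.sum x) := s1.mul_left _
  have s6 : HasSum (fun n => p (n+1) (fun _ => x) - p (n+1) (fun _ => π x)) (l x * q.sum x) := by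
    refine s5.congr_fun ?_ |> id
    intro n
    rw [hq, telescope_aux n (p (n+1)) x (π x) e (l x) (hπ x)]
  have s7 := (hasSum_nat_add_iff' 1).2 s4
  have h0 : p 0 (fun _ => x) = p 0 (fun _ => π x) := by congr 1; funext j; exact j.elim0
  simp only [Finset.sum_range_one, h0, sub_self, sub_zero] at s7
  have := s7.unique s6
  linarith

/-- The monomial with exponent `α`. -/
def mon {d : ℕ} (α : Fin d → ℕ) (x : Fin d → ℝ) : ℝ := ∏ i, x i ^ α i

/-- A germ at the origin which is a monomial times a unit. -/
def IsMono {d : ℕ} (f : (Fin d → ℝ) → ℝ) : Prop :=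
  ∃ (α : Fin d → ℕ) (u : (Fin d → ℝ) → ℝ), AnalyticAt ℝ u 0 ∧ u 0 ≠ 0 ∧
    ∀ᶠ x in 𝓝 (0 : Fin d → ℝ), f x = mon α x * u x

lemma analyticAt_coord {d : ℕ} (i : Fin d) (a : Fin d → ℝ) :
    AnalyticAt ℝ (fun x : Fin d → ℝ => x i) a :=
  (ContinuousLinearMap.proj (R := ℝ) (φ := fun _ : Fin d => ℝ) i).analyticAt a

lemma mon_add {d : ℕ} (α β : Fin d → ℕ) (x : Fin d → ℝ) :
    mon (α + β) x = mon α x * mon β x := by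
  simp [mon, pow_add, Finset.prod_mul_distrib]

lemma mon_zero {d : ℕ} (x : Fin d → ℝ) : mon 0 x = 1 := by simp [mon]

lemma mon_single {d : ℕ} (i : Fin d) (x : Fin d → ℝ) : mon (Pi.single i 1) x = x i := by
  classical
  rw [mon, Finset.prod_eq_single i]
  · simp
  · intro j _ hj; simp [Pi.single_eq_of_ne hj]
  · simp

lemma mon_nsmul {d : ℕ} (k : ℕ) (α : Fin d → ℕ) (x : Fin d → ℝ) :
    mon (k • α) x = mon α x ^ k := by
  simp only [mon, Pi.smul_apply, smul_eq_mul, ← Finset.prod_pow]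
  exact Finset.prod_congr rfl fun i _ => by rw [mul_comm, pow_mul]

lemma analyticAt_finset_prod {E ι : Type*} [NormedAddCommGroup E] [NormedSpace ℝ E]
    (s : Finset ι) (f : ι → E → ℝ) (a : E) (hf : ∀ i ∈ s, AnalyticAt ℝ (f i) a) :
    AnalyticAt ℝ (fun x => ∏ i ∈ s, f i x) a := by
  classical
  induction s using Finset.induction_on with
  | empty => simpa using analyticAt_const
  | insert i s hi ih =>
    simp only [Finset.prod_insert hi]
    exact (hf i (Finset.mem_insert_self _ _)).mul (ih fun j hj => hf j (Finset.mem_insert_of_mem hj))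

lemma analyticAt_finset_sum {E ι : Type*} [NormedAddCommGroup E] [NormedSpace ℝ E]
    (s : Finset ι) (f : ι → E → ℝ) (a : E) (hf : ∀ i ∈ s, AnalyticAt ℝ (f i) a) :
    AnalyticAt ℝ (fun x => ∑ i ∈ s, f i x) a := by
  classical
  induction s using Finset.induction_on with
  | empty => simpa using analyticAt_const
  | insert i s hi ih =>
    simp only [Finset.sum_insert hi]
    exact (hf i (Finset.mem_insert_self _ _)).add (ih fun j hj => hf j (Finset.mem_insert_of_mem hj))

lemma analyticAt_mon {d : ℕ} (α : Fin d → ℕ) (a : Fin d → ℝ) : AnalyticAt ℝ (mon α) a :=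
  analyticAt_finset_prod _ (fun i (x : Fin d → ℝ) => x i ^ α i) a
    fun i _ => (analyticAt_coord i a).pow _

lemma mon_ne_zero {d : ℕ} {α : Fin d → ℕ} {x : Fin d → ℝ} (h : ∀ i, α i ≠ 0 → x i ≠ 0) :
    mon α x ≠ 0 := by
  refine Finset.prod_ne_zero_iff.2 fun i _ => ?_
  by_cases hi : α i = 0
  · simp [hi]
  · exact pow_ne_zero _ (h i hi)

lemma mon_eq_zero {d : ℕ} {α : Fin d → ℕ} {x : Fin d → ℝ} {i : Fin d} (h : α i ≠ 0)
    (hx : x i = 0) : mon α x = 0 :=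
  Finset.prod_eq_zero (Finset.mem_univ i) (by simp [hx, h])

lemma IsMono.mul {d : ℕ} {f g : (Fin d → ℝ) → ℝ} (hf : IsMono f) (hg : IsMono g) :
    IsMono (fun x => f x * g x) := by
  obtain ⟨α, u, hu, hu0, h1⟩ := hf
  obtain ⟨β, v, hv, hv0, h2⟩ := hg
  refine ⟨α + β, fun x => u x * v x, hu.mul hv, mul_ne_zero hu0 hv0, ?_⟩
  filter_upwards [h1, h2] with x h1 h2
  rw [h1, h2, mon_add]; ring

lemma IsMono.congr {d : ℕ} {f g : (Fin d → ℝ) → ℝ} (hf : IsMono f)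
    (h : ∀ᶠ x in 𝓝 (0 : Fin d → ℝ), g x = f x) : IsMono g := by
  obtain ⟨α, u, hu, hu0, h1⟩ := hf
  refine ⟨α, u, hu, hu0, ?_⟩
  filter_upwards [h1, h] with x h1 h
  rw [h, h1]

lemma IsMono.of_ne_zero {d : ℕ} {f : (Fin d → ℝ) → ℝ} (hf : AnalyticAt ℝ f 0) (h : f 0 ≠ 0) :
    IsMono f := ⟨0, f, hf, h, Eventually.of_forall fun x => by simp [mon_zero]⟩

lemma IsMono.coord {d : ℕ} (i : Fin d) : IsMono (fun x : Fin d → ℝ => x i) :=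
  ⟨Pi.single i 1, fun _ => 1, analyticAt_const, one_ne_zero,
    Eventually.of_forall fun x => by simp [mon_single]⟩

lemma IsMono.pow {d : ℕ} {f : (Fin d → ℝ) → ℝ} (hf : IsMono f) (k : ℕ) :
    IsMono (fun x => f x ^ k) := by
  induction k with
  | zero => simpa using IsMono.of_ne_zero (f := fun _ : Fin d → ℝ => (1:ℝ)) analyticAt_const one_ne_zero
  | succ k ih => simpa only [pow_succ] using ih.mul hf

lemma IsMono.prod {d : ℕ} {ι : Type*} (s : Finset ι) (f : ι → (Fin d → ℝ) → ℝ)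
    (h : ∀ i ∈ s, IsMono (f i)) : IsMono (fun x => ∏ i ∈ s, f i x) := by
  classical
  induction s using Finset.induction_on with
  | empty => simpa using IsMono.of_ne_zero (f := fun _ : Fin d → ℝ => (1:ℝ)) analyticAt_const one_ne_zero
  | insert i s hi ih =>
    simp only [Finset.prod_insert hi]
    exact (h i (Finset.mem_insert_self _ _)).mul (ih fun j hj => h j (Finset.mem_insert_of_mem hj))

/-- A map whose coordinates are monomial pulls monomial germs back to monomial germs. -/
lemma IsMono.comp {d e : ℕ} {f : (Fin d → ℝ) → ℝ} (hf : IsMono f)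
    {φ : (Fin e → ℝ) → (Fin d → ℝ)} (hφ : AnalyticAt ℝ φ 0) (hφ0 : φ 0 = 0)
    (hm : ∀ i, IsMono (fun x => φ x i)) : IsMono (fun x => f (φ x)) := by
  obtain ⟨α, u, hu, hu0, h1⟩ := hf
  have ht : Tendsto φ (𝓝 0) (𝓝 0) := by simpa [hφ0] using hφ.continuousAt.tendsto
  have h2 : IsMono (fun x => mon α (φ x) * u (φ x)) := by
    refine IsMono.mul ?_ (IsMono.of_ne_zero ?_ (by simpa [hφ0] using hu0))
    · exact IsMono.prod _ _ fun i _ => (hm i).pow _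
    · have : AnalyticAt ℝ u (φ 0) := by rwa [hφ0]
      exact this.comp hφ
  exact h2.congr (ht.eventually h1)

lemma IsMono.not_zero {d : ℕ} {f : (Fin d → ℝ) → ℝ} (hf : IsMono f) :
    ¬ ∀ᶠ x in 𝓝 (0 : Fin d → ℝ), f x = 0 := by
  obtain ⟨α, u, hu, hu0, h1⟩ := hf
  intro h
  have hu' := hu.continuousAt.eventually_ne hu0
  obtain ⟨r, hr, hb⟩ := Metric.eventually_nhds_iff_ball.1 (h.and (h1.and hu'))
  have hx : (fun _ => r/2 : Fin d → ℝ) ∈ Metric.ball (0 : Fin d → ℝ) r := by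
    rw [mem_ball_zero_iff, pi_norm_lt_iff hr]
    intro i; rw [Real.norm_eq_abs, abs_of_pos (by positivity)]; linarith
  obtain ⟨h2, h3, h4⟩ := hb _ hx
  rw [h2] at h3
  exact mul_ne_zero (mon_ne_zero (fun i _ => by positivity)) h4 h3.symm

lemma coord_division {d : ℕ} (i : Fin d) {f : (Fin d → ℝ) → ℝ} (hf : AnalyticAt ℝ f 0) :
    ∃ f1 : (Fin d → ℝ) → ℝ, AnalyticAt ℝ f1 0 ∧
      ∀ᶠ x in 𝓝 (0 : Fin d → ℝ), f x = f (Function.update x i 0) + x i * f1 x := by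
  let l : (Fin d → ℝ) →L[ℝ] ℝ := ContinuousLinearMap.proj (R := ℝ) (φ := fun _ : Fin d => ℝ) i
  let e : Fin d → ℝ := Pi.single i 1
  let π : (Fin d → ℝ) →L[ℝ] (Fin d → ℝ) := ContinuousLinearMap.id ℝ _ - l.smulRight e
  have hπ : ∀ x, π x = Function.update x i 0 := by
    intro x; funext j
    by_cases hj : j = i
    · subst hj; simp [π, l, e]
    · simp [π, l, e, hj]
  obtain ⟨f1, h1, h2⟩ := analytic_division π l e (fun x => by simp [π]) hf
  refine ⟨f1, h1, ?_⟩
  filter_upwards [h2] with x hx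
  rw [hx, hπ]; rfl

lemma analyticAt_update_zero {d : ℕ} (i : Fin d) (a : Fin d → ℝ) :
    AnalyticAt ℝ (fun x : Fin d → ℝ => Function.update x i 0) a := by
  refine AnalyticAt.pi fun j => ?_
  by_cases hj : j = i
  · subst hj; simpa using analyticAt_const
  · simpa [hj] using analyticAt_coord j a

lemma update_zero_zero {d : ℕ} (i : Fin d) : Function.update (0 : Fin d → ℝ) i 0 = 0 := by
  simp

lemma tendsto_update_zero {d : ℕ} (i : Fin d) :
    Tendsto (fun x : Fin d → ℝ => Function.update x i 0) (𝓝 0) (𝓝 0) := by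
  have := (analyticAt_update_zero i (0 : Fin d → ℝ)).continuousAt.tendsto
  simpa using this

/-- A factor of a monomial germ is a monomial germ. -/
lemma IsMono.of_mul {d : ℕ} {f g : (Fin d → ℝ) → ℝ} (hf : AnalyticAt ℝ f 0)
    (hg : AnalyticAt ℝ g 0) (h : IsMono (fun x => f x * g x)) : IsMono f := by
  obtain ⟨α, u, hu, hu0, h1⟩ := h
  obtain ⟨n, hn⟩ : ∃ n, ∑ i, α i = n := ⟨_, rfl⟩
  induction n generalizing α f g with
  | zero =>
    have hα : α = 0 := by
      funext i; exact (Finset.sum_eq_zero_iff.1 hn) i (Finset.mem_univ i)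
    subst hα
    have := h1.self_of_nhds
    rw [mon_zero, one_mul] at this
    refine IsMono.of_ne_zero hf fun h => hu0 ?_
    rw [← this]; simp [h]
  | succ n ih =>
    obtain ⟨i, hi⟩ : ∃ i, α i ≠ 0 := by
      by_contra hc; push Not at hc; simp [hc] at hn
    obtain ⟨β, hβ⟩ : ∃ β : Fin d → ℕ, α = Pi.single i 1 + β := by
      refine ⟨α - Pi.single i 1, ?_⟩
      funext j
      by_cases hj : j = i
      · subst hj; simp; omega
      · simp [hj]
    have hβn : ∑ i, β i = n := by
      rw [hβ] at hn
      simp [Finset.sum_add_distrib] at hn; omega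
    have hup := analyticAt_update_zero i (0 : Fin d → ℝ)
    have hres : ∀ {k : (Fin d → ℝ) → ℝ}, AnalyticAt ℝ k 0 →
        AnalyticAt ℝ (fun x => k (Function.update x i 0)) 0 := by
      intro k hk
      have : AnalyticAt ℝ k (Function.update (0 : Fin d → ℝ) i 0) := by simpa using hk
      exact AnalyticAt.fun_comp (g := k) this hup
    have hprod : ∀ᶠ x in 𝓝 (0 : Fin d → ℝ),
        f (Function.update x i 0) * g (Function.update x i 0) = 0 := by
      filter_upwards [(tendsto_update_zero i).eventually h1] with x hx
      rw [hx, mon_eq_zero hi (by simp), zero_mul]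
    -- cancellation of the coordinate
    have cancel : ∀ {a b : (Fin d → ℝ) → ℝ}, AnalyticAt ℝ a 0 → AnalyticAt ℝ b 0 →
        (∀ᶠ x in 𝓝 (0 : Fin d → ℝ), x i * (a x * b x) = mon α x * u x) →
        ∀ᶠ x in 𝓝 (0 : Fin d → ℝ), a x * b x = mon β x * u x := by
      intro a b ha hb hab
      have : ∀ᶠ x in 𝓝 (0 : Fin d → ℝ), x i * (a x * b x - mon β x * u x) = 0 := by
        filter_upwards [hab] with x hx
        rw [hβ, mon_add, mon_single] at hx
        linear_combination hx
      rcases germ_mul_eq_zero (analyticAt_coord i 0)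
        ((ha.mul hb).sub ((analyticAt_mon β 0).mul hu)) this with h | h
      · exact absurd h (IsMono.coord i).not_zero
      · filter_upwards [h] with x hx
        exact sub_eq_zero.1 hx
    rcases germ_mul_eq_zero (hres hf) (hres hg) hprod with h | h
    · obtain ⟨f1, hf1, hd⟩ := coord_division i hf
      have hd' : ∀ᶠ x in 𝓝 (0 : Fin d → ℝ), f x = x i * f1 x := by
        filter_upwards [h, hd] with x h hd
        rw [hd, h, zero_add]
      have := ih hf1 hg β (cancel hf1 hg (by
        filter_upwards [hd', h1] with x hx h1
        rw [← h1, hx]; ring)) hβn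
      exact ((IsMono.coord i).mul this).congr hd'
    · obtain ⟨g1, hg1, hd⟩ := coord_division i hg
      have hd' : ∀ᶠ x in 𝓝 (0 : Fin d → ℝ), g x = x i * g1 x := by
        filter_upwards [h, hd] with x h hd
        rw [hd, h, zero_add]
      exact ih hf hg1 β (cancel hf hg1 (by
        filter_upwards [hd', h1] with x hx h1
        rw [← h1, hx]; ring)) hβn

lemma IsMono.of_prod {d : ℕ} {ι : Type*} (s : Finset ι) (f : ι → (Fin d → ℝ) → ℝ)
    (hf : ∀ i ∈ s, AnalyticAt ℝ (f i) 0) (h : IsMono (fun x => ∏ i ∈ s, f i x)) :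
    ∀ i ∈ s, IsMono (f i) := by
  classical
  intro i hi
  refine IsMono.of_mul (g := fun x => ∏ j ∈ s.erase i, f j x) (hf i hi)
    (analyticAt_finset_prod _ _ _ fun j hj => hf j (Finset.mem_of_mem_erase hj)) ?_
  refine h.congr (Eventually.of_forall fun x => ?_)
  exact Finset.mul_prod_erase s (fun j => f j x) hi

/-- Nonzero germs multiply to nonzero germs. -/
lemma germ_prod_ne_zero {E ι : Type*} [NormedAddCommGroup E] [NormedSpace ℝ E] (a : E)
    (s : Finset ι) (f : ι → E → ℝ)
    (hf : ∀ i ∈ s, AnalyticAt ℝ (f i) a) (h : ∀ i ∈ s, ¬ ∀ᶠ x in 𝓝 a, f i x = 0) :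
    ¬ ∀ᶠ x in 𝓝 a, ∏ i ∈ s, f i x = 0 := by
  classical
  induction s using Finset.induction_on with
  | empty => 
    intro h
    have := h.self_of_nhds
    simp at this
  | insert i s hi ih =>
    simp only [Finset.prod_insert hi]
    intro hc
    rcases germ_mul_eq_zero (hf i (Finset.mem_insert_self _ _))
      (analyticAt_finset_prod s f a fun j hj => hf j (Finset.mem_insert_of_mem hj)) hc with h1 | h1
    · exact h i (Finset.mem_insert_self _ _) h1
    · exact ih (fun j hj => hf j (Finset.mem_insert_of_mem hj))
        (fun j hj => h j (Finset.mem_insert_of_mem hj)) h1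

/-- Exponents of monomials with monomial (or zero) difference are comparable. -/
lemma mono_comparable {d : ℕ} (α β : Fin d → ℕ) (u v : (Fin d → ℝ) → ℝ)
    (hu : AnalyticAt ℝ u 0) (hv : AnalyticAt ℝ v 0)
    (hu0 : u 0 ≠ 0) (hv0 : v 0 ≠ 0)
    (h : (∀ᶠ x in 𝓝 (0 : Fin d → ℝ), mon α x * u x - mon β x * v x = 0) ∨
      IsMono (fun x => mon α x * u x - mon β x * v x)) :
    α ≤ β ∨ β ≤ α := by
  by_contra hc
  rw [not_or, Pi.le_def, Pi.le_def] at hc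
  push Not at hc
  obtain ⟨⟨i, hi⟩, ⟨j, hj⟩⟩ := hc
  obtain ⟨μ, α', β', hα, hβ, hdis⟩ : ∃ μ α' β' : Fin d → ℕ, α = μ + α' ∧ β = μ + β' ∧
      ∀ k, α' k = 0 ∨ β' k = 0 := by
    refine ⟨fun k => min (α k) (β k), fun k => α k - min (α k) (β k),
      fun k => β k - min (α k) (β k), ?_, ?_, ?_⟩
    · funext k; simp
    · funext k; simp
    · intro k; simp only; omega
  have hi' : α' i ≠ 0 := by
    have h1 := congrFun hα i; have h2 := congrFun hβ i
    simp only [Pi.add_apply] at h1 h2; omega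
  have hj' : β' j ≠ 0 := by
    have h1 := congrFun hα j; have h2 := congrFun hβ j
    simp only [Pi.add_apply] at h1 h2; omega
  have hβi : β' i = 0 := (hdis i).resolve_left hi'
  have hαj : α' j = 0 := (hdis j).resolve_right hj'
  have hmμ : IsMono (mon μ) := ⟨μ, fun _ => 1, analyticAt_const, one_ne_zero,
    Eventually.of_forall fun x => by simp⟩
  have han : AnalyticAt ℝ (fun x => mon α' x * u x - mon β' x * v x) 0 :=
    ((analyticAt_mon α' 0).mul hu).sub ((analyticAt_mon β' 0).mul hv)
  have hfac : ∀ x, mon α x * u x - mon β x * v x =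
      (mon α' x * u x - mon β' x * v x) * mon μ x := by
    intro x; rw [hα, hβ, mon_add, mon_add]; ring
  have h' : (∀ᶠ x in 𝓝 (0 : Fin d → ℝ), mon α' x * u x - mon β' x * v x = 0) ∨
      IsMono (fun x => mon α' x * u x - mon β' x * v x) := by
    simp only [hfac] at h
    rcases h with h | h
    · left
      rcases germ_mul_eq_zero han (analyticAt_mon μ 0) h with h | h
      · exact h
      · exact absurd h hmμ.not_zero
    · right; exact IsMono.of_mul han (analyticAt_mon μ 0) h
  -- test points
  have test : ∀ P : (Fin d → ℝ) → Prop, (∀ᶠ x in 𝓝 (0 : Fin d → ℝ), P x) →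
      ∃ r : ℝ, 0 < r ∧ ∀ x : Fin d → ℝ, (∀ k, x k = 0 ∨ x k = r) → P x := by
    intro P hP
    obtain ⟨r, hr, hb⟩ := Metric.eventually_nhds_iff_ball.1 hP
    refine ⟨r/2, by positivity, fun x hx => hb x ?_⟩
    rw [mem_ball_zero_iff, pi_norm_lt_iff hr]
    intro k
    rcases hx k with h | h
    · simpa [h] using hr
    · rw [h, Real.norm_eq_abs, abs_of_pos (by positivity)]; linarith
  rcases h' with h' | ⟨δ, w, hw, hw0, h'⟩
  · obtain ⟨r, hr, ht⟩ := test _ (h'.and (hv.continuousAt.eventually_ne hv0))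
    obtain ⟨h1, h2⟩ := ht (fun k => if k = i then 0 else r) (fun k => by by_cases h : k = i <;> simp [h])
    rw [mon_eq_zero hi' (by simp), zero_mul, zero_sub, neg_eq_zero] at h1
    refine mul_ne_zero (mon_ne_zero fun k hk => ?_) h2 h1
    have : k ≠ i := by rintro rfl; exact hk hβi
    simp [this, hr.ne']
  · replace h' : ∀ᶠ x in 𝓝 (0 : Fin d → ℝ), mon α' x * u x - mon β' x * v x = mon δ x * w x := h'
    obtain ⟨k, hk⟩ : ∃ k, δ k ≠ 0 := by
      by_contra hc
      push Not at hc
      have h0 := h'.self_of_nhds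
      have hδ : δ = 0 := funext hc
      rw [hδ, mon_zero, one_mul, mon_eq_zero hi' rfl, mon_eq_zero hj' rfl] at h0
      apply hw0; rw [← h0]; ring
    obtain ⟨r, hr, ht⟩ := test _ (h'.and ((hv.continuousAt.eventually_ne hv0).and
      (hu.continuousAt.eventually_ne hu0)))
    by_cases hβk : β' k = 0
    · obtain ⟨h1, h2, -⟩ := ht (fun l => if l = i ∨ l = k then 0 else r)
        (fun l => by by_cases h : l = i ∨ l = k <;> simp [h])
      rw [mon_eq_zero hi' (by simp), mon_eq_zero hk (by simp), zero_mul, zero_mul, zero_sub,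
        neg_eq_zero] at h1
      refine mul_ne_zero (mon_ne_zero fun l hl => ?_) h2 h1
      have h3 : l ≠ i := by rintro rfl; exact hl hβi
      have h4 : l ≠ k := by rintro rfl; exact hl hβk
      simp [h3, h4, hr.ne']
    · have hαk := (hdis k).resolve_right hβk
      obtain ⟨h1, -, h2⟩ := ht (fun l => if l = k then 0 else r)
        (fun l => by by_cases h : l = k <;> simp [h])
      rw [mon_eq_zero hβk (by simp), mon_eq_zero hk (by simp), zero_mul, zero_mul, sub_zero] at h1
      refine mul_ne_zero (mon_ne_zero fun l hl => ?_) h2 h1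
      have h4 : l ≠ k := by rintro rfl; exact hl hαk
      simp [h4, hr.ne']

/-- Prepend a coordinate. -/
def cns {d : ℕ} (t : ℝ) (y : Fin d → ℝ) : Fin (d+1) → ℝ := Fin.cons (α := fun _ => ℝ) t y

/-- Forget the first coordinate. -/
def tl {d : ℕ} (x : Fin (d+1) → ℝ) : Fin d → ℝ := fun i => x i.succ

@[simp] lemma cns_zero {d : ℕ} (t : ℝ) (y : Fin d → ℝ) : cns t y 0 = t := rfl
@[simp] lemma cns_succ {d : ℕ} (t : ℝ) (y : Fin d → ℝ) (i : Fin d) : cns t y i.succ = y i := rfl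
@[simp] lemma tl_cns {d : ℕ} (t : ℝ) (y : Fin d → ℝ) : tl (cns t y) = y := rfl
@[simp] lemma tl_zero {d : ℕ} : tl (0 : Fin (d+1) → ℝ) = 0 := rfl
@[simp] lemma tl_apply {d : ℕ} (x : Fin (d+1) → ℝ) (i : Fin d) : tl x i = x i.succ := rfl
@[simp] lemma cns_tl {d : ℕ} (x : Fin (d+1) → ℝ) : cns (x 0) (tl x) = x := by
  funext i; refine Fin.cases rfl (fun j => rfl) i
@[simp] lemma cns_zero_zero {d : ℕ} : cns 0 (0 : Fin d → ℝ) = 0 := by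
  funext i; refine Fin.cases rfl (fun j => rfl) i
lemma cns_ext {d : ℕ} {x y : Fin (d+1) → ℝ} (h0 : x 0 = y 0) (h : tl x = tl y) : x = y := by
  rw [← cns_tl x, ← cns_tl y, h0, h]

lemma analyticAt_cns {E : Type*} [NormedAddCommGroup E] [NormedSpace ℝ E] {d : ℕ} {a : E}
    {T : E → ℝ} {Y : E → Fin d → ℝ} (hT : AnalyticAt ℝ T a) (hY : AnalyticAt ℝ Y a) :
    AnalyticAt ℝ (fun x => cns (T x) (Y x)) a := by
  refine AnalyticAt.pi fun i => ?_
  refine Fin.cases ?_ (fun j => ?_) i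
  · simpa using hT
  · simpa using analyticAt_pi_iff.1 hY j

lemma analyticAt_tl {d : ℕ} (a : Fin (d+1) → ℝ) : AnalyticAt ℝ (tl (d := d)) a :=
  AnalyticAt.pi fun i => analyticAt_coord i.succ a

lemma tendsto_tl {d : ℕ} : Tendsto (tl (d := d)) (𝓝 0) (𝓝 0) := by
  simpa using (analyticAt_tl (0 : Fin (d+1) → ℝ)).continuousAt.tendsto

lemma AnalyticAt.comp_tl {d : ℕ} {c : (Fin d → ℝ) → ℝ} (hc : AnalyticAt ℝ c 0) :
    AnalyticAt ℝ (fun x : Fin (d+1) → ℝ => c (tl x)) 0 :=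
  AnalyticAt.fun_comp (g := c) (by simpa using hc) (analyticAt_tl 0)

lemma analyticAt_cns0 {d : ℕ} (a : Fin d → ℝ) : AnalyticAt ℝ (fun y : Fin d → ℝ => cns 0 y) a :=
  analyticAt_cns analyticAt_const analyticAt_id

lemma tendsto_cns0 {d : ℕ} : Tendsto (fun y : Fin d → ℝ => cns 0 y) (𝓝 0) (𝓝 0) := by
  simpa using (analyticAt_cns0 (0 : Fin d → ℝ)).continuousAt.tendsto

/-- The basis vector of the first coordinate. -/
def e0 {d : ℕ} : Fin (d+1) → ℝ := cns 1 0

/-- Derivative with respect to the first coordinate. -/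
noncomputable def D0 {d : ℕ} (f : (Fin (d+1) → ℝ) → ℝ) (x : Fin (d+1) → ℝ) : ℝ :=
  fderiv ℝ f x e0

lemma D0_analytic {d : ℕ} {f : (Fin (d+1) → ℝ) → ℝ} {a} (hf : AnalyticAt ℝ f a) :
    AnalyticAt ℝ (D0 f) a :=
  AnalyticAt.fun_comp (g := fun L : (Fin (d+1) → ℝ) →L[ℝ] ℝ => L e0)
    ((ContinuousLinearMap.apply ℝ ℝ (e0 (d := d))).analyticAt _) hf.fderiv

lemma D0_iter_analytic {d : ℕ} {f : (Fin (d+1) → ℝ) → ℝ} {a} (hf : AnalyticAt ℝ f a) (k : ℕ) :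
    AnalyticAt ℝ (D0^[k] f) a := by
  induction k with
  | zero => exact hf
  | succ k ih => rw [Function.iterate_succ_apply']; exact D0_analytic ih

lemma D0_congr {d : ℕ} {f g : (Fin (d+1) → ℝ) → ℝ} {a} (h : f =ᶠ[𝓝 a] g) :
    D0 f =ᶠ[𝓝 a] D0 g := by
  filter_upwards [h.fderiv (𝕜 := ℝ)] with x hx
  simp only [D0]; rw [hx]

lemma D0_iter_congr {d : ℕ} {f g : (Fin (d+1) → ℝ) → ℝ} {a} (h : f =ᶠ[𝓝 a] g) (k : ℕ) :
    D0^[k] f =ᶠ[𝓝 a] D0^[k] g := by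
  induction k with
  | zero => exact h
  | succ k ih => simp only [Function.iterate_succ_apply']; exact D0_congr ih

lemma D0_eq_deriv {d : ℕ} {f : (Fin (d+1) → ℝ) → ℝ} {x} (hf : DifferentiableAt ℝ f x) {c : ℝ}
    (h : HasDerivAt (fun s : ℝ => f (x + s • e0)) c 0) : D0 f x = c := by
  have h1 := (hf.hasFDerivAt.hasLineDerivAt (e0 (d := d)))
  exact HasDerivAt.unique h1 h

lemma D0_coord_mul {d : ℕ} {f : (Fin (d+1) → ℝ) → ℝ} (hf : AnalyticAt ℝ f 0) :
    D0 (fun x => x 0 * f x) =ᶠ[𝓝 0] fun x => x 0 * D0 f x + f x := by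
  filter_upwards [hf.eventually_analyticAt] with x hx
  have h1 : HasFDerivAt (fun x : Fin (d+1) → ℝ => x 0)
    (ContinuousLinearMap.proj (R := ℝ) (φ := fun _ : Fin (d+1) => ℝ) 0) x :=
    (ContinuousLinearMap.proj (R := ℝ) (φ := fun _ : Fin (d+1) => ℝ) 0).hasFDerivAt
  have h2 := h1.mul hx.differentiableAt.hasFDerivAt
  simp only [D0]
  have h3 : fderiv ℝ (fun x => x 0 * f x) x = _ := h2.fderiv
  rw [h3]
  simp [e0]

lemma D0_add {d : ℕ} {f g : (Fin (d+1) → ℝ) → ℝ} (hf : AnalyticAt ℝ f 0) (hg : AnalyticAt ℝ g 0) :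
    D0 (fun x => f x + g x) =ᶠ[𝓝 0] fun x => D0 f x + D0 g x := by
  filter_upwards [hf.eventually_analyticAt, hg.eventually_analyticAt] with x h1 h2
  simp only [D0]
  have h3 : fderiv ℝ (fun x => f x + g x) x = _ :=
    (h1.differentiableAt.hasFDerivAt.add h2.differentiableAt.hasFDerivAt).fderiv
  rw [h3]; rfl

lemma D0_iter_add {d : ℕ} {f g : (Fin (d+1) → ℝ) → ℝ} (hf : AnalyticAt ℝ f 0)
    (hg : AnalyticAt ℝ g 0) (k : ℕ) :
    D0^[k] (fun x => f x + g x) =ᶠ[𝓝 0] fun x => D0^[k] f x + D0^[k] g x := by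
  induction k with
  | zero => exact EventuallyEq.rfl
  | succ k ih =>
    simp only [Function.iterate_succ_apply']
    exact (D0_congr ih).trans (D0_add (D0_iter_analytic hf k) (D0_iter_analytic hg k))

lemma tl_add_e0 {d : ℕ} (x : Fin (d+1) → ℝ) (s : ℝ) : tl (x + s • e0) = tl x := by
  funext i; simp [e0]

lemma D0_comp_tl {d : ℕ} {c : (Fin d → ℝ) → ℝ} (hc : AnalyticAt ℝ c 0) :
    D0 (fun x => c (tl x)) =ᶠ[𝓝 0] fun _ => 0 := by
  filter_upwards [hc.comp_tl.eventually_analyticAt] with x hx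
  refine D0_eq_deriv hx.differentiableAt ?_
  simp only [tl_add_e0]
  exact hasDerivAt_const _ _

lemma D0_iter_zero {d : ℕ} (k : ℕ) : D0^[k] (fun _ : Fin (d+1) → ℝ => (0:ℝ)) = fun _ => 0 := by
  induction k with
  | zero => rfl
  | succ k ih => rw [Function.iterate_succ_apply', ih]; funext x; simp [D0]

lemma D0_iter_comp_tl {d : ℕ} {c : (Fin d → ℝ) → ℝ} (hc : AnalyticAt ℝ c 0) (k : ℕ) :
    D0^[k+1] (fun x => c (tl x)) =ᶠ[𝓝 0] fun _ => 0 := by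
  rw [Function.iterate_succ_apply]
  have := D0_iter_congr (D0_comp_tl hc) k
  rwa [D0_iter_zero] at this

lemma D0_iter_coord_mul {d : ℕ} {f : (Fin (d+1) → ℝ) → ℝ} (hf : AnalyticAt ℝ f 0) (k : ℕ) :
    D0^[k+1] (fun x => x 0 * f x) =ᶠ[𝓝 0] fun x => x 0 * D0^[k+1] f x + (k+1) * D0^[k] f x := by
  induction k with
  | zero => simpa using D0_coord_mul hf
  | succ k ih =>
    rw [Function.iterate_succ_apply']
    refine (D0_congr ih).trans ?_
    have ha := D0_iter_analytic hf (k+1)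
    have hb := D0_iter_analytic hf k
    have h1 := D0_add ((analyticAt_coord (0 : Fin (d+1)) 0).mul ha)
      ((analyticAt_const (v := ((k:ℝ)+1)) (x := (0 : Fin (d+1) → ℝ))).mul hb)
    filter_upwards [h1, D0_coord_mul ha, hb.eventually_analyticAt] with x h1 h2 h3
    have h4 : D0 (fun x => ((k:ℝ)+1) * D0^[k] f x) x = (k+1) * D0^[k+1] f x := by
      rw [Function.iterate_succ_apply']
      simp only [D0]
      rw [fderiv_const_mul h3.differentiableAt]; rfl
    have h1' : D0 (fun x => x 0 * D0^[k+1] f x + ((k:ℝ)+1) * D0^[k] f x) x =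
      D0 (fun x => x 0 * D0^[k+1] f x) x + D0 (fun x => ((k:ℝ)+1) * D0^[k] f x) x := h1
    rw [h1', h2, h4, Function.iterate_succ_apply' D0 (k+1)]
    push_cast; ring

/-- Taylor expansion in the first coordinate. -/
lemma taylor0 {d : ℕ} (m : ℕ) {f : (Fin (d+1) → ℝ) → ℝ} (hf : AnalyticAt ℝ f 0) :
    ∃ (a : ℕ → (Fin d → ℝ) → ℝ) (u : (Fin (d+1) → ℝ) → ℝ), (∀ i, AnalyticAt ℝ (a i) 0) ∧
      AnalyticAt ℝ u 0 ∧
      (∀ᶠ x in 𝓝 (0 : Fin (d+1) → ℝ),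
        f x = ∑ i ∈ Finset.range m, a i (tl x) * x 0 ^ i + x 0 ^ m * u x) ∧
      (∀ k < m, ∀ᶠ y in 𝓝 (0 : Fin d → ℝ), D0^[k] f (cns 0 y) = k.factorial * a k y) ∧
      D0^[m] f 0 = m.factorial * u 0 := by
  induction m generalizing f with
  | zero =>
    exact ⟨fun _ _ => 0, f, fun _ => analyticAt_const, hf, by simp, by simp, by simp⟩
  | succ m ih =>
    obtain ⟨f1, hf1, hd⟩ := coord_division 0 hf
    obtain ⟨a, u, ha, hu, h1, h2, h3⟩ := ih hf1
    let a0 : (Fin d → ℝ) → ℝ := fun y => f (cns 0 y)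
    have ha0 : AnalyticAt ℝ a0 0 :=
      AnalyticAt.fun_comp (g := f) (by simpa using hf) (analyticAt_cns0 0)
    have hd' : f =ᶠ[𝓝 0] fun x => a0 (tl x) + x 0 * f1 x := by
      filter_upwards [hd] with x hx
      rw [hx]
      have : Function.update x 0 0 = cns 0 (tl x) := by
        refine cns_ext (by simp) ?_
        funext i; simp
      rw [this]
    have hD : ∀ k, D0^[k+1] f =ᶠ[𝓝 0] fun x => x 0 * D0^[k+1] f1 x + (k+1) * D0^[k] f1 x := by
      intro k
      have hA := (analyticAt_coord (0 : Fin (d+1)) 0).mul hf1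
      filter_upwards [D0_iter_congr hd' (k+1), D0_iter_add ha0.comp_tl hA (k+1),
        D0_iter_comp_tl ha0 k, D0_iter_coord_mul hf1 k] with x h1 h2 h3 h4
      rw [h1]
      refine h2.trans ?_
      rw [h3, zero_add]
      exact h4
    refine ⟨fun i => match i with | 0 => a0 | j+1 => a j, u, ?_, hu, ?_, ?_, ?_⟩
    · rintro (_ | i)
      · exact ha0
      · exact ha i
    · filter_upwards [hd', h1] with x hd' h1
      rw [hd', h1, Finset.sum_range_succ', mul_add, Finset.mul_sum]
      simp only [pow_zero, mul_one]
      have : ∀ i, x 0 * (a i (tl x) * x 0 ^ i) = a i (tl x) * x 0 ^ (i+1) := by intro i; ring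
      simp only [this]
      ring
    · rintro (_ | k) hk
      · simp [a0]
      · filter_upwards [tendsto_cns0.eventually (hD k), h2 k (by omega)] with y hy1 hy2
        rw [hy1, hy2]
        simp [Nat.factorial_succ]; ring
    · have : D0^[m+1] f 0 = (0 : Fin (d+1) → ℝ) 0 * D0^[m+1] f1 0 + (m+1) * D0^[m] f1 0 :=
        (hD m).self_of_nhds
      rw [this, h3]
      simp [Nat.factorial_succ]; ring

/-- Analytic implicit function theorem, in the form needed. -/
lemma implicit0 {d : ℕ} {G : (Fin (d+1) → ℝ) → ℝ} (hG : AnalyticAt ℝ G 0) (hG0 : G 0 = 0)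
    (hD : D0 G 0 ≠ 0) :
    ∃ g : (Fin d → ℝ) → ℝ, AnalyticAt ℝ g 0 ∧ g 0 = 0 ∧ ∀ᶠ y in 𝓝 0, G (cns (g y) y) = 0 := by
  let Φ : (Fin (d+1) → ℝ) → (Fin (d+1) → ℝ) := fun x => cns (G x) (tl x)
  have hΦ : AnalyticAt ℝ Φ 0 := analyticAt_cns hG (analyticAt_tl 0)
  have hΦ0 : Φ 0 = 0 := by simp [Φ, hG0]
  have hval : ∀ v i, fderiv ℝ Φ 0 v i = fderiv ℝ (fun x => Φ x i) 0 v := by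
    intro v i
    have h := hasFDerivAt_pi'.1 hΦ.differentiableAt.hasFDerivAt i
    rw [h.fderiv]; rfl
  have hinj : Function.Injective (fderiv ℝ Φ 0 : (Fin (d+1) → ℝ) →ₗ[ℝ] (Fin (d+1) → ℝ)) := by
    rw [← LinearMap.ker_eq_bot, LinearMap.ker_eq_bot']
    intro v hv
    have hv' : ∀ i, fderiv ℝ (fun x => Φ x i) 0 v = 0 := by
      intro i; rw [← hval]; exact congrFun hv i
    have htl : tl v = 0 := by
      funext i
      have h := hv' i.succ
      have h2 : HasFDerivAt (fun x => Φ x i.succ)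
        (ContinuousLinearMap.proj (R := ℝ) (φ := fun _ : Fin (d+1) => ℝ) i.succ) 0 :=
        (ContinuousLinearMap.proj (R := ℝ) (φ := fun _ : Fin (d+1) => ℝ) i.succ).hasFDerivAt
      rw [h2.fderiv] at h
      simpa using h
    have hve : v = v 0 • e0 := by
      refine cns_ext (by simp [e0]) ?_
      rw [htl]; funext i; simp [e0]
    have h := hv' 0
    have h2 : (fun x => Φ x 0) = G := rfl
    rw [h2, hve, map_smul, smul_eq_mul] at h
    have : v 0 = 0 := (mul_eq_zero.1 h).resolve_right hD
    rw [hve, this, zero_smul]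
  let L : (Fin (d+1) → ℝ) ≃L[ℝ] (Fin (d+1) → ℝ) :=
    (LinearEquiv.ofInjectiveEndo _ hinj).toContinuousLinearEquiv
  have hL : (L : (Fin (d+1) → ℝ) →L[ℝ] (Fin (d+1) → ℝ)) = fderiv ℝ Φ 0 := by
    ext v; rfl
  have hs : HasStrictFDerivAt Φ (L : (Fin (d+1) → ℝ) →L[ℝ] (Fin (d+1) → ℝ)) 0 := by
    rw [hL]; exact hΦ.hasStrictFDerivAt
  let R := hs.toOpenPartialHomeomorph Φ
  have hmem : (0 : Fin (d+1) → ℝ) ∈ R.source := hs.mem_toOpenPartialHomeomorph_source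
  have hR : ∀ x, R x = Φ x := fun x => rfl
  have hR0 : R 0 = 0 := hΦ0
  have hsymm : AnalyticAt ℝ R.symm 0 := by
    have := R.analyticAt_symm' (i := L) hmem hΦ (by
      change fderiv ℝ Φ 0 = _; rw [hL])
    rwa [hR0] at this
  have hsymm0 : R.symm 0 = 0 := by
    have := R.left_inv hmem; rwa [hR0] at this
  refine ⟨fun y => R.symm (cns 0 y) 0, ?_, by simp [hsymm0], ?_⟩
  · have h1 : AnalyticAt ℝ (fun y : Fin d → ℝ => R.symm (cns 0 y)) 0 :=
      AnalyticAt.fun_comp (g := R.symm) (by simpa using hsymm) (analyticAt_cns0 0)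
    exact analyticAt_pi_iff.1 h1 0
  · have ht : R.target ∈ 𝓝 (0 : Fin (d+1) → ℝ) := by
      have := R.map_source hmem; rw [hR0] at this
      exact R.open_target.mem_nhds this
    filter_upwards [tendsto_cns0.eventually ht] with y hy
    have h1 : Φ (R.symm (cns 0 y)) = cns 0 y := R.right_inv hy
    have h2 : tl (R.symm (cns 0 y)) = y := by
      have := congrArg tl h1; simpa [Φ] using this
    have h3 : G (R.symm (cns 0 y)) = 0 := by
      have := congrFun h1 0; simpa [Φ] using this
    have h4 : cns (R.symm (cns 0 y) 0) y = R.symm (cns 0 y) := by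
      conv_rhs => rw [← cns_tl (R.symm (cns 0 y)), h2]
    rw [h4, h3]

/-- The shear translating the first coordinate. -/
def shear {d : ℕ} (g : (Fin d → ℝ) → ℝ) (x : Fin (d+1) → ℝ) : Fin (d+1) → ℝ :=
  cns (x 0 + g (tl x)) (tl x)

lemma shear_analytic {d : ℕ} {g : (Fin d → ℝ) → ℝ} (hg : AnalyticAt ℝ g 0) :
    AnalyticAt ℝ (shear g) 0 :=
  analyticAt_cns ((analyticAt_coord 0 0).add hg.comp_tl) (analyticAt_tl 0)

lemma shear_zero {d : ℕ} {g : (Fin d → ℝ) → ℝ} (hg : g 0 = 0) : shear g 0 = 0 := by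
  simp [shear, hg]

lemma shear_add_e0 {d : ℕ} (g : (Fin d → ℝ) → ℝ) (x : Fin (d+1) → ℝ) (s : ℝ) :
    shear g (x + s • e0) = shear g x + s • e0 := by
  refine cns_ext ?_ ?_
  · simp only [shear, tl_add_e0, cns_zero, Pi.add_apply, Pi.smul_apply]
    simp [e0]; ring
  · rw [tl_add_e0]; simp [shear, tl_add_e0]

lemma D0_shear {d : ℕ} {g : (Fin d → ℝ) → ℝ} (hg : AnalyticAt ℝ g 0) (hg0 : g 0 = 0)
    {f : (Fin (d+1) → ℝ) → ℝ} (hf : AnalyticAt ℝ f 0) :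
    D0 (fun x => f (shear g x)) =ᶠ[𝓝 0] fun x => D0 f (shear g x) := by
  have hs := shear_analytic hg
  have hst : Tendsto (shear g) (𝓝 0) (𝓝 0) := by
    simpa [shear_zero hg0] using hs.continuousAt.tendsto
  filter_upwards [hs.eventually_analyticAt, hst.eventually hf.eventually_analyticAt] with x h1 h2
  have h3 : DifferentiableAt ℝ (fun x => f (shear g x)) x :=
    h2.differentiableAt.comp x h1.differentiableAt
  refine D0_eq_deriv h3 ?_
  simp only [shear_add_e0]
  exact h2.differentiableAt.hasFDerivAt.hasLineDerivAt e0

lemma D0_iter_shear {d : ℕ} {g : (Fin d → ℝ) → ℝ} (hg : AnalyticAt ℝ g 0) (hg0 : g 0 = 0)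
    {f : (Fin (d+1) → ℝ) → ℝ} (hf : AnalyticAt ℝ f 0) (k : ℕ) :
    D0^[k] (fun x => f (shear g x)) =ᶠ[𝓝 0] fun x => D0^[k] f (shear g x) := by
  induction k with
  | zero => exact EventuallyEq.rfl
  | succ k ih =>
    simp only [Function.iterate_succ_apply']
    exact (D0_congr ih).trans (D0_shear hg hg0 (D0_iter_analytic hf k))

/-- `φ` is an analytic chart at the origin through which the ultrafilter lifts, by the section `s`. -/
structure Chart {d : ℕ} (φ s : (Fin d → ℝ) → (Fin d → ℝ)) (U : Ultrafilter (Fin d → ℝ)) : Prop where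
  an : AnalyticAt ℝ φ 0
  zero : φ 0 = 0
  sec : ∀ᶠ x in (U : Filter (Fin d → ℝ)), φ (s x) = x
  tend : Tendsto s U (𝓝 0)

lemma Chart.tendsto {d : ℕ} {φ s : (Fin d → ℝ) → (Fin d → ℝ)} {U} (h : Chart φ s U) :
    Tendsto φ (𝓝 0) (𝓝 0) := by
  simpa [h.zero] using h.an.continuousAt.tendsto

lemma Chart.comp {d : ℕ} {φ s φ' s' : (Fin d → ℝ) → (Fin d → ℝ)} {U : Ultrafilter (Fin d → ℝ)}
    (h : Chart φ s U) (h' : Chart φ' s' (U.map s)) :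
    Chart (fun x => φ (φ' x)) (fun x => s' (s x)) U where
  an := AnalyticAt.fun_comp (g := φ) (by rw [h'.zero]; exact h.an) h'.an
  zero := by simp [h.zero, h'.zero]
  sec := by
    have h1 : ∀ᶠ x in (U : Filter (Fin d → ℝ)), φ' (s' (s x)) = s x := h'.sec
    filter_upwards [h.sec, h1] with x h2 h3
    rw [h3, h2]
  tend := h'.tend.comp (show Tendsto s U (U.map s) from tendsto_map)

lemma Chart.le {d : ℕ} {φ s : (Fin d → ℝ) → (Fin d → ℝ)} {U : Ultrafilter (Fin d → ℝ)}
    (h : Chart φ s U) : ((U.map s : Ultrafilter (Fin d → ℝ)) : Filter (Fin d → ℝ)) ≤ 𝓝 0 := h.tend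

/-- `f` can be monomialized along the ultrafilter `U`. -/
def Mz {d : ℕ} (f : (Fin d → ℝ) → ℝ) (U : Ultrafilter (Fin d → ℝ)) : Prop :=
  ∃ φ s, Chart φ s U ∧ IsMono (fun x => f (φ x))

lemma Mz.of_chart {d : ℕ} {f : (Fin d → ℝ) → ℝ} {φ s : (Fin d → ℝ) → (Fin d → ℝ)}
    {U : Ultrafilter (Fin d → ℝ)}
    (h : Chart φ s U) (h' : Mz (fun x => f (φ x)) (U.map s)) : Mz f U := by
  obtain ⟨φ', s', h1, h2⟩ := h'
  exact ⟨_, _, h.comp h1, h2⟩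

lemma Mz.congr {d : ℕ} {f g : (Fin d → ℝ) → ℝ} {U : Ultrafilter (Fin d → ℝ)}
    (hf : Mz f U) (h : ∀ᶠ x in 𝓝 (0 : Fin d → ℝ), g x = f x) : Mz g U := by
  obtain ⟨φ', s', h1, h2⟩ := hf
  exact ⟨φ', s', h1, h2.congr (h1.tendsto.eventually h)⟩

lemma Chart.id {d : ℕ} {U : Ultrafilter (Fin d → ℝ)} (hU : (U : Filter (Fin d → ℝ)) ≤ 𝓝 0) :
    Chart (fun x => x) (fun x => x) U :=
  ⟨analyticAt_id, rfl, Eventually.of_forall fun _ => rfl, hU⟩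

lemma tendsto_coord {d : ℕ} (i : Fin d) : Tendsto (fun x : Fin d → ℝ => x i) (𝓝 0) (𝓝 0) := by
  simpa using (analyticAt_coord i (0 : Fin d → ℝ)).continuousAt.tendsto

lemma tendsto_cns {d : ℕ} {ι : Type*} {l : Filter ι} {T : ι → ℝ} {Y : ι → Fin d → ℝ}
    (hT : Tendsto T l (𝓝 0)) (hY : Tendsto Y l (𝓝 0)) :
    Tendsto (fun x => cns (T x) (Y x)) l (𝓝 0) := by
  refine tendsto_pi_nhds.2 fun i => ?_
  refine Fin.cases ?_ (fun j => ?_) i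
  · simpa using hT
  · simpa using (tendsto_pi_nhds.1 hY) j

lemma Chart.lift {d : ℕ} {φ s : (Fin d → ℝ) → (Fin d → ℝ)} {U : Ultrafilter (Fin (d+1) → ℝ)}
    (hU : (U : Filter (Fin (d+1) → ℝ)) ≤ 𝓝 0) (h : Chart φ s (U.map tl)) :
    Chart (fun x => cns (x 0) (φ (tl x))) (fun x => cns (x 0) (s (tl x))) U where
  an := analyticAt_cns (analyticAt_coord 0 0)
    (AnalyticAt.fun_comp (g := φ) (by simpa using h.an) (analyticAt_tl 0))
  zero := by simp [h.zero]
  sec := by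
    have h1 : ∀ᶠ x in (U : Filter (Fin (d+1) → ℝ)), φ (s (tl x)) = tl x := h.sec
    filter_upwards [h1] with x h1
    simp [h1]
  tend := tendsto_cns ((tendsto_coord 0).mono_left hU)
    (show Tendsto (s ∘ tl) U (𝓝 0) from tendsto_map'_iff.1 h.tend)

/-- Limits of bounded real functions along ultrafilters. -/
lemma ultra_lim {X : Type*} (U : Ultrafilter X) (τ : X → ℝ) (M : ℝ)
    (h : ∀ᶠ x in (U : Filter X), |τ x| ≤ M) : ∃ τ0, Tendsto τ U (𝓝 τ0) := by
  have hc : IsCompact (Icc (-M) M) := isCompact_Icc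
  obtain ⟨a, -, ha⟩ := hc.ultrafilter_le_nhds (U.map τ) (by
    rw [le_principal_iff]
    change ∀ᶠ x in (U : Filter X), τ x ∈ Icc (-M) M
    filter_upwards [h] with x hx
    exact abs_le.1 hx)
  exact ⟨a, ha⟩

/-- Substituting powers of the coordinates. -/
lemma power_chart {d : ℕ} {U : Ultrafilter (Fin d → ℝ)} (hU : (U : Filter (Fin d → ℝ)) ≤ 𝓝 0)
    {N : ℕ} (hN : N ≠ 0) :
    ∃ (ε : Fin d → ℝ) (s : (Fin d → ℝ) → (Fin d → ℝ)), (∀ i, ε i ≠ 0) ∧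
      Chart (fun z i => ε i * z i ^ N) s U := by
  have h1 : ∀ i : Fin d, ∃ e : ℝ, e ≠ 0 ∧ ∀ᶠ x in (U : Filter (Fin d → ℝ)), e * |x i| = x i := by
    intro i
    rcases Ultrafilter.eventually_or.1 (Eventually.of_forall (f := (U : Filter (Fin d → ℝ)))
      fun x : Fin d → ℝ => le_total 0 (x i)) with h | h
    · exact ⟨1, one_ne_zero, h.mono fun x hx => by rw [abs_of_nonneg hx, one_mul]⟩
    · exact ⟨-1, by norm_num, h.mono fun x hx => by rw [abs_of_nonpos hx]; ring⟩
  choose ε hε h2 using h1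
  refine ⟨ε, fun x i => |x i| ^ ((N : ℝ)⁻¹), hε, ?_, ?_, ?_, ?_⟩
  · exact AnalyticAt.pi fun i => analyticAt_const.mul ((analyticAt_coord i 0).pow N)
  · funext i; simp [hN]
  · filter_upwards [eventually_all.2 h2] with x hx
    funext i
    rw [Real.rpow_inv_natCast_pow (abs_nonneg _) hN, hx]
  · refine tendsto_pi_nhds.2 fun i => ?_
    have h3 : Tendsto (fun x : Fin d → ℝ => |x i|) U (𝓝 0) := by
      simpa using ((tendsto_coord i).mono_left hU).abs
    have h4 := h3.rpow_const (p := (N:ℝ)⁻¹) (Or.inr (by positivity))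
    rwa [Real.zero_rpow (by simpa using hN)] at h4

lemma mon_power {d : ℕ} (N : ℕ) (ε : Fin d → ℝ) (α : Fin d → ℕ) (z : Fin d → ℝ) :
    mon α (fun i => ε i * z i ^ N) = mon α ε * mon (N • α) z := by
  simp only [mon, mul_pow, Finset.prod_mul_distrib, Pi.smul_apply, smul_eq_mul, pow_mul]

lemma poly_aux (m : ℕ) (hm : 1 ≤ m) (p : Polynomial ℝ) (hd : p.natDegree ≤ m)
    (hc : p.coeff (m-1) = 0) (τ : ℝ) (w : ℝ → ℝ) (hw : ContinuousAt w 0)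
    (h : ∀ᶠ t in 𝓝 (0:ℝ), p.eval (τ + t) = t ^ m * w t) : ∀ i < m, p.coeff i = 0 := by
  open Polynomial in
  set q := taylor τ p with hq
  have hqe : ∀ t, q.eval t = p.eval (τ + t) := by
    intro t; rw [hq, taylor_eval, add_comm]
  have hdvd : ∀ k ≤ m, X ^ k ∣ q := by
    intro k
    induction k with
    | zero => intro _; simp
    | succ k ih =>
      intro hk
      obtain ⟨q', hq'⟩ := ih (by omega)
      have h1 : ∀ᶠ t in 𝓝[≠] (0:ℝ), q'.eval t = t ^ (m-k) * w t := by
        filter_upwards [h.filter_mono nhdsWithin_le_nhds, self_mem_nhdsWithin] with t ht ht0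
        have ht0' : t ≠ 0 := ht0
        rw [← hqe, hq', eval_mul, eval_pow, eval_X] at ht
        have : t ^ m = t ^ k * t ^ (m-k) := by rw [← pow_add]; congr 1; omega
        rw [this, mul_assoc] at ht
        exact mul_left_cancel₀ (pow_ne_zero _ ht0') ht
      have h2 : Tendsto (fun t => q'.eval t) (𝓝[≠] (0:ℝ)) (𝓝 (q'.eval 0)) :=
        q'.continuous.continuousAt.tendsto.mono_left nhdsWithin_le_nhds
      have h3 : Tendsto (fun t => t ^ (m-k) * w t) (𝓝[≠] (0:ℝ)) (𝓝 0) := by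
        have : ContinuousAt (fun t => t ^ (m-k) * w t) (0:ℝ) := (continuousAt_id.pow _).mul hw
        have h4 := this.tendsto.mono_left (nhdsWithin_le_nhds (s := {0}ᶜ))
        have h5 : m - k ≠ 0 := by omega
        simpa [h5] using h4
      have h0 : q'.eval 0 = 0 := tendsto_nhds_unique h2 (h3.congr' (h1.mono fun t ht => ht.symm))
      have : X ∣ q' := by rw [X_dvd_iff, coeff_zero_eq_eval_zero, h0]
      obtain ⟨q'', hq''⟩ := this
      exact ⟨q'', by rw [hq', hq'', pow_succ]; ring⟩
  obtain ⟨r, hr⟩ := hdvd m le_rfl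
  have hqd : q.natDegree ≤ m := by rw [hq, natDegree_taylor]; exact hd
  have hqc : q = C (q.coeff m) * X ^ m := by
    ext k
    rw [coeff_C_mul_X_pow]
    split_ifs with hk
    · rw [hk]
    · rcases lt_or_gt_of_ne hk with hk | hk
      · exact X_pow_dvd_iff.1 (hdvd m le_rfl) k hk
      · exact coeff_eq_zero_of_natDegree_lt (by omega)
  have hp : p = C (q.coeff m) * (X - C τ) ^ m := by
    have : taylor (-τ) q = p := by rw [hq, taylor_taylor]; simp
    rw [← this, hqc]
    simp [taylor_apply, sub_eq_add_neg]
  set r0 := q.coeff m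
  have hc' := hc
  rw [hp, coeff_C_mul, sub_eq_add_neg, ← C_neg, coeff_X_add_C_pow] at hc'
  have h6 : m - (m-1) = 1 := by omega
  have h7 : m.choose (m-1) = m := by
    rw [Nat.choose_symm_of_eq_add (show m = (m-1) + 1 by omega)]; simp
  rw [h6, h7, pow_one] at hc'
  have hm0 : (m:ℝ) ≠ 0 := by positivity
  intro i hi
  rcases mul_eq_zero.1 hc' with h8 | h8
  · rw [hp, h8]; simp
  · have h9 : τ = 0 := by
      rcases mul_eq_zero.1 h8 with h | h
      · linarith
      · exact absurd h hm0
    rw [hp, h9]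
    simp [coeff_X_pow, hi.ne]

lemma mon_split {d : ℕ} (γ : Fin d → ℕ) (j : Fin d) (y : Fin d → ℝ) :
    mon γ y = y j ^ γ j * ∏ i ∈ Finset.univ.erase j, y i ^ γ i := by
  rw [mon, Finset.mul_prod_erase _ (fun i => y i ^ γ i) (Finset.mem_univ j)]

lemma ultra_not {X : Type*} {U : Ultrafilter X} {p : X → Prop}
    (h : ¬ ∀ᶠ x in (U : Filter X), p x) : ∀ᶠ x in (U : Filter X), ¬ p x :=
  Ultrafilter.eventually_not.2 h

lemma small_of_dominated {X : Type*} {U : Ultrafilter X} {A B : X → ℝ}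
    (h : ∀ M : ℝ, ∀ᶠ x in (U : Filter X), M * |A x| < |B x|) :
    Tendsto (fun x => A x / B x) U (𝓝 0) := by
  rw [Metric.tendsto_nhds]
  intro ε hε
  filter_upwards [h ε⁻¹] with x hx
  rw [Real.dist_eq, sub_zero, abs_div]
  have hB : 0 < |B x| := lt_of_le_of_lt (by positivity) hx
  rw [div_lt_iff₀ hB]
  rw [inv_mul_lt_iff₀ hε] at hx
  exact hx

lemma combin {d : ℕ} (n : ℕ) : ∀ (γ : Fin d → ℕ) (_ : ∑ i, γ i = n)
    (U : Ultrafilter (Fin (d+1) → ℝ)) (_ : (U : Filter (Fin (d+1) → ℝ)) ≤ 𝓝 0)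
    (_ : ∀ M : ℝ, ∀ᶠ x in (U : Filter (Fin (d+1) → ℝ)), M * |mon γ (tl x)| < |x 0|),
    ∃ (Ψ s : (Fin (d+1) → ℝ) → (Fin (d+1) → ℝ)) (r : (Fin (d+1) → ℝ) → ℝ), Chart Ψ s U ∧
      (∀ i, IsMono (fun x => Ψ x i)) ∧ AnalyticAt ℝ r 0 ∧ r 0 = 0 ∧
      ∀ x, mon γ (tl (Ψ x)) = Ψ x 0 * r x := by
  induction n with
  | zero =>
    intro γ hγ U hU h
    exfalso
    have hγ0 : γ = 0 := by
      funext i; simpa using (Finset.sum_eq_zero_iff.1 hγ) i (Finset.mem_univ i)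
    have h1 : ∀ᶠ x in (U : Filter (Fin (d+1) → ℝ)), |x 0| < 1 := by
      have h2 : Tendsto (fun x : Fin (d+1) → ℝ => |x 0|) U (𝓝 0) := by
        simpa using ((tendsto_coord 0).mono_left hU).abs
      exact h2.eventually (gt_mem_nhds one_pos)
    obtain ⟨x, hx1, hx2⟩ := ((h 1).and h1).exists
    rw [hγ0, mon_zero, abs_one] at hx1
    linarith
  | succ n ih =>
    intro γ hγ U hU h
    obtain ⟨j, hj⟩ : ∃ j, γ j ≠ 0 := by
      by_contra hcon
      push Not at hcon
      simp [hcon] at hγ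
    have hne : (0 : Fin (d+1)) ≠ j.succ := (Fin.succ_ne_zero j).symm
    by_cases hcase : ∃ M : ℝ, ∀ᶠ x in (U : Filter (Fin (d+1) → ℝ)), |x j.succ| ≤ M * |x 0|
    · obtain ⟨M, hM⟩ := hcase
      have hx0 : ∀ᶠ x in (U : Filter (Fin (d+1) → ℝ)), x 0 ≠ 0 := by
        filter_upwards [h 1] with x hx
        have : 0 < |x 0| := lt_of_le_of_lt (by positivity) hx
        exact abs_pos.1 this
      obtain ⟨w0, hw0⟩ := ultra_lim U (fun x => x j.succ / x 0) M (by
        filter_upwards [hM, hx0] with x h1 h2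
        rw [abs_div, div_le_iff₀ (abs_pos.2 h2)]; exact h1)
      let Ψ : (Fin (d+1) → ℝ) → (Fin (d+1) → ℝ) :=
        fun x => Function.update x j.succ (x 0 * (w0 + x j.succ))
      let s : (Fin (d+1) → ℝ) → (Fin (d+1) → ℝ) :=
        fun x => Function.update x j.succ (x j.succ / x 0 - w0)
      let r : (Fin (d+1) → ℝ) → ℝ := fun x => x 0 ^ (γ j - 1) * (w0 + x j.succ) ^ γ j *
        ∏ i ∈ Finset.univ.erase j, x i.succ ^ γ i
      have hΨ0 : ∀ x, Ψ x 0 = x 0 := fun x => Function.update_of_ne hne _ _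
      have hs0 : ∀ x, s x 0 = x 0 := fun x => Function.update_of_ne hne _ _
      have hΨj : ∀ x, Ψ x j.succ = x 0 * (w0 + x j.succ) := fun x => Function.update_self ..
      have hΨi : ∀ x i, i ≠ j.succ → Ψ x i = x i := fun x i hi => Function.update_of_ne hi _ _
      have hr : ∀ x, mon γ (tl (Ψ x)) = Ψ x 0 * r x := by
        intro x
        rw [mon_split γ j, tl_apply, hΨj, hΨ0]
        have h1 : ∏ i ∈ Finset.univ.erase j, tl (Ψ x) i ^ γ i =
            ∏ i ∈ Finset.univ.erase j, x i.succ ^ γ i := by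
          refine Finset.prod_congr rfl fun i hi => ?_
          rw [tl_apply, hΨi x i.succ]
          intro h; exact (Finset.ne_of_mem_erase hi) (Fin.succ_injective _ h)
        rw [h1, mul_pow]
        have h2 : x 0 ^ γ j = x 0 * x 0 ^ (γ j - 1) := by
          rw [← pow_succ']; congr 1; omega
        rw [h2]; simp only [r]; ring
      have hr_an : AnalyticAt ℝ r 0 :=
        (((analyticAt_coord 0 0).pow _).mul ((analyticAt_const.add (analyticAt_coord j.succ 0)).pow _)).mul
          (analyticAt_finset_prod _ (fun i (x : Fin (d+1) → ℝ) => x i.succ ^ γ i) 0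
            fun i _ => (analyticAt_coord _ 0).pow _)
      have hchart : Chart Ψ s U := by
        refine ⟨?_, ?_, ?_, ?_⟩
        · refine AnalyticAt.pi fun i => ?_
          by_cases hi : i = j.succ
          · subst hi
            change AnalyticAt ℝ (fun x => Ψ x j.succ) 0
            simp only [hΨj]
            exact (analyticAt_coord 0 0).mul (analyticAt_const.add (analyticAt_coord _ 0))
          · change AnalyticAt ℝ (fun x => Ψ x i) 0
            simp only [hΨi _ i hi]; exact analyticAt_coord i 0
        · funext i
          by_cases hi : i = j.succ
          · subst hi; rw [hΨj]; simp
          · rw [hΨi _ i hi]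
        · filter_upwards [hx0] with x hx
          funext i
          by_cases hi : i = j.succ
          · subst hi; rw [hΨj, hs0]; simp only [s, Function.update_self]
            field_simp; ring
          · rw [hΨi _ i hi]; exact Function.update_of_ne hi _ _
        · refine tendsto_pi_nhds.2 fun i => ?_
          by_cases hi : i = j.succ
          · subst hi; simp only [s, Function.update_self]
            simpa using hw0.sub_const w0
          · simp only [s, Function.update_of_ne hi]
            exact (tendsto_coord i).mono_left hU
      refine ⟨Ψ, s, r, hchart, ?_, hr_an, ?_, hr⟩
      · intro i
        by_cases hi : i = j.succ
        · subst hi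
          simp only [hΨj]
          refine (IsMono.coord 0).mul ?_
          by_cases hw : w0 = 0
          · simpa [hw] using IsMono.coord j.succ
          · exact IsMono.of_ne_zero (analyticAt_const.add (analyticAt_coord _ 0)) (by simpa using hw)
        · simp only [hΨi _ i hi]; exact IsMono.coord i
      · have h1 : Tendsto (fun x => r (s x)) U (𝓝 (r 0)) :=
          hr_an.continuousAt.tendsto.comp hchart.tend
        have h2 := small_of_dominated h
        refine tendsto_nhds_unique h1 (h2.congr' ?_)
        filter_upwards [hx0, hchart.sec] with x hx hsec
        have := hr (s x)
        rw [hsec] at this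
        rw [this]; field_simp
    · push Not at hcase
      have hcase' : ∀ M : ℝ, ∀ᶠ x in (U : Filter (Fin (d+1) → ℝ)), M * |x 0| < |x j.succ| :=
        hcase
      have hxj : ∀ᶠ x in (U : Filter (Fin (d+1) → ℝ)), x j.succ ≠ 0 := by
        filter_upwards [hcase' 1] with x hx
        exact abs_pos.1 (lt_of_le_of_lt (by positivity) hx)
      let Ψ1 : (Fin (d+1) → ℝ) → (Fin (d+1) → ℝ) := fun x => cns (x j.succ * x 0) (tl x)
      let s1 : (Fin (d+1) → ℝ) → (Fin (d+1) → ℝ) := fun x => cns (x 0 / x j.succ) (tl x)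
      have hchart1 : Chart Ψ1 s1 U := by
        refine ⟨analyticAt_cns ((analyticAt_coord _ 0).mul (analyticAt_coord _ 0)) (analyticAt_tl 0),
          by simp [Ψ1], ?_, tendsto_cns (small_of_dominated hcase') (tendsto_tl.mono_left hU)⟩
        filter_upwards [hxj] with x hx
        refine cns_ext ?_ rfl
        simp only [Ψ1, s1, cns_zero, cns_succ, tl_apply]
        field_simp
      let γ' : Fin d → ℕ := Function.update γ j (γ j - 1)
      have hγ' : ∀ y : Fin d → ℝ, mon γ y = y j * mon γ' y := by
        intro y
        rw [mon_split γ j, mon_split γ' j, ← mul_assoc]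
        have h1 : γ' j = γ j - 1 := Function.update_self ..
        rw [h1, ← pow_succ', Nat.sub_add_cancel (by omega)]
        congr 1
        refine Finset.prod_congr rfl fun i hi => ?_
        simp only [γ']
        rw [Function.update_of_ne (Finset.ne_of_mem_erase hi)]
      have hsum : ∑ i, γ' i = n := by
        have h1 := Finset.add_sum_erase Finset.univ γ (Finset.mem_univ j)
        have h2 := Finset.add_sum_erase Finset.univ γ' (Finset.mem_univ j)
        have h3 : ∑ i ∈ Finset.univ.erase j, γ' i = ∑ i ∈ Finset.univ.erase j, γ i :=
          Finset.sum_congr rfl fun i hi => Function.update_of_ne (Finset.ne_of_mem_erase hi) _ _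
        have h4 : γ' j = γ j - 1 := Function.update_self ..
        omega
      obtain ⟨Ψ, s, r, hc, hm, hra, hr0, hr⟩ := ih γ' hsum (U.map s1) hchart1.le (by
        intro M
        change ∀ᶠ x in (U : Filter (Fin (d+1) → ℝ)), M * |mon γ' (tl (s1 x))| < |s1 x 0|
        filter_upwards [hxj, h M] with x hx hM
        simp only [s1, tl_cns, cns_zero, abs_div]
        rw [lt_div_iff₀ (abs_pos.2 hx)]
        rw [hγ', abs_mul, tl_apply] at hM
        linarith)
      refine ⟨fun x => Ψ1 (Ψ x), fun x => s (s1 x), r, hchart1.comp hc, ?_, hra, hr0, ?_⟩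
      · intro i
        refine Fin.cases ?_ (fun k => ?_) i
        · exact (hm j.succ).mul (hm 0)
        · exact hm k.succ
      · intro x
        simp only [Ψ1, tl_cns, cns_zero]
        rw [hγ', hr, tl_apply, mul_assoc]

/-- The hypothesis used in the induction on the order in the first variable. -/
def Pm (d m : ℕ) : Prop :=
  ∀ (c : (Fin d → ℝ) → ℝ) (f : (Fin (d+1) → ℝ) → ℝ) (U : Ultrafilter (Fin (d+1) → ℝ)),
    AnalyticAt ℝ c 0 → (¬ ∀ᶠ y in 𝓝 0, c y = 0) → AnalyticAt ℝ f 0 → D0^[m] f 0 ≠ 0 →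
    (U : Filter (Fin (d+1) → ℝ)) ≤ 𝓝 0 → Mz (fun x => c (tl x) * f x) U

lemma caseB {d m : ℕ} {γ : Fin d → ℕ} {a : ℕ → (Fin d → ℝ) → ℝ} {u f : (Fin (d+1) → ℝ) → ℝ}
    {c : (Fin d → ℝ) → ℝ}
    (ha : ∀ i, AnalyticAt ℝ (a i) 0) (hu : AnalyticAt ℝ u 0) (hu0 : u 0 ≠ 0) (hc : IsMono c)
    (hf : ∀ᶠ x in 𝓝 (0 : Fin (d+1) → ℝ), f x = ∑ i ∈ Finset.range m,
      (mon γ (tl x)) ^ (m-i) * a i (tl x) * x 0 ^ i + x 0 ^ m * u x)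
    {U : Ultrafilter (Fin (d+1) → ℝ)} (hU : (U : Filter (Fin (d+1) → ℝ)) ≤ 𝓝 0)
    (h : ∀ M : ℝ, ∀ᶠ x in (U : Filter (Fin (d+1) → ℝ)), M * |mon γ (tl x)| < |x 0|) :
    Mz (fun x => c (tl x) * f x) U := by
  obtain ⟨Ψ, s, r, hch, hm, hra, hr0, hr⟩ := combin _ γ rfl U hU h
  refine ⟨Ψ, s, hch, ?_⟩
  have hta : AnalyticAt ℝ (fun x => tl (Ψ x)) 0 :=
    AnalyticAt.fun_comp (g := tl) (analyticAt_tl _) hch.an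
  have ht0 : tl (Ψ 0) = 0 := by rw [hch.zero, tl_zero]
  have h1 : IsMono (fun x => c (tl (Ψ x))) := hc.comp hta ht0 (fun i => hm i.succ)
  let v : (Fin (d+1) → ℝ) → ℝ :=
    fun x => ∑ i ∈ Finset.range m, r x ^ (m-i) * a i (tl (Ψ x)) + u (Ψ x)
  have hv : AnalyticAt ℝ v 0 := by
    refine AnalyticAt.add (analyticAt_finset_sum _ (fun i x => r x ^ (m-i) * a i (tl (Ψ x))) 0
      fun i _ => (hra.pow _).mul ?_) ?_
    · exact AnalyticAt.fun_comp (g := a i) (by rw [ht0]; exact ha i) hta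
    · exact AnalyticAt.fun_comp (g := u) (by rw [hch.zero]; exact hu) hch.an
  have hv0 : v 0 ≠ 0 := by
    have : v 0 = u 0 := by
      simp only [v, hr0, hch.zero]
      rw [Finset.sum_eq_zero, zero_add]
      intro i hi
      have : m - i ≠ 0 := by have := Finset.mem_range.1 hi; omega
      simp [this]
    rwa [this]
  refine h1.mul ((((hm 0).pow m).mul (IsMono.of_ne_zero hv hv0)).congr ?_)
  filter_upwards [hch.tendsto.eventually hf] with x hx
  rw [hx]
  simp only [v, mul_add, Finset.mul_sum]
  congr 1
  refine Finset.sum_congr rfl fun i hi => ?_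
  have : Ψ x 0 ^ m = Ψ x 0 ^ (m-i) * Ψ x 0 ^ i := by
    rw [← pow_add]; congr 1; have := Finset.mem_range.1 hi; omega
  rw [hr, mul_pow, this]; ring

lemma caseA {d m : ℕ} (hm : 1 ≤ m) (hP : ∀ k < m, Pm d k) {γ : Fin d → ℕ} (hγ : γ ≠ 0)
    {a : ℕ → (Fin d → ℝ) → ℝ} {u f : (Fin (d+1) → ℝ) → ℝ} {c : (Fin d → ℝ) → ℝ}
    (ha : ∀ i, AnalyticAt ℝ (a i) 0) (ham : a (m-1) 0 = 0) (hai : ∃ i < m, a i 0 ≠ 0)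
    (hu : AnalyticAt ℝ u 0) (hc : IsMono c) (hca : AnalyticAt ℝ c 0)
    (hf : ∀ᶠ x in 𝓝 (0 : Fin (d+1) → ℝ), f x = ∑ i ∈ Finset.range m,
      (mon γ (tl x)) ^ (m-i) * a i (tl x) * x 0 ^ i + x 0 ^ m * u x)
    {U : Ultrafilter (Fin (d+1) → ℝ)} (hU : (U : Filter (Fin (d+1) → ℝ)) ≤ 𝓝 0)
    (M : ℝ) (h : ∀ᶠ x in (U : Filter (Fin (d+1) → ℝ)), |x 0| ≤ M * |mon γ (tl x)|) :
    Mz (fun x => c (tl x) * f x) U := by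
  obtain ⟨τ, hτ⟩ := ultra_lim U (fun x => x 0 / mon γ (tl x)) |M| (by
    filter_upwards [h] with x hx
    rw [abs_div]
    refine div_le_of_le_mul₀ (abs_nonneg _) (abs_nonneg _) (hx.trans ?_)
    exact mul_le_mul_of_nonneg_right (le_abs_self M) (abs_nonneg _))
  have hγ0 : mon γ (0 : Fin d → ℝ) = 0 := by
    obtain ⟨i, hi⟩ := Function.ne_iff.1 hγ
    exact mon_eq_zero hi rfl
  let φ : (Fin (d+1) → ℝ) → (Fin (d+1) → ℝ) := fun x => cns (mon γ (tl x) * (τ + x 0)) (tl x)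
  let s : (Fin (d+1) → ℝ) → (Fin (d+1) → ℝ) := fun x => cns (x 0 / mon γ (tl x) - τ) (tl x)
  have hT : AnalyticAt ℝ (fun x : Fin (d+1) → ℝ => τ + x 0) 0 :=
    analyticAt_const.add (analyticAt_coord 0 0)
  have hch : Chart φ s U := by
    refine ⟨analyticAt_cns ((analyticAt_mon γ 0).comp_tl.mul hT) (analyticAt_tl 0),
      by simp [φ, hγ0], ?_, tendsto_cns (by simpa using hτ.sub_const τ) (tendsto_tl.mono_left hU)⟩
    filter_upwards [h] with x hx
    refine cns_ext ?_ rfl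
    simp only [φ, s, cns_zero, tl_cns]
    by_cases h0 : mon γ (tl x) = 0
    · rw [h0, abs_zero, mul_zero] at hx
      rw [h0, zero_mul]
      exact (abs_nonpos_iff.1 hx).symm
    · field_simp; ring
  refine Mz.of_chart hch ?_
  let F : (Fin (d+1) → ℝ) → ℝ := fun x => ∑ i ∈ Finset.range m, a i (tl x) * (τ + x 0) ^ i +
    (τ + x 0) ^ m * u (φ x)
  have hF : AnalyticAt ℝ F 0 := by
    refine AnalyticAt.add (analyticAt_finset_sum _ (fun i x => a i (tl x) * (τ + x 0) ^ i) 0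
      fun i _ => (ha i).comp_tl.mul (hT.pow i)) ((hT.pow m).mul ?_)
    exact AnalyticAt.fun_comp (g := u) (by rw [hch.zero]; exact hu) hch.an
  have hk : ∃ k < m, D0^[k] F 0 ≠ 0 := by
    by_contra hcon
    push Not at hcon
    obtain ⟨b, w, hb, hw, h1, h2, -⟩ := taylor0 m hF
    have hb0 : ∀ k < m, b k 0 = 0 := by
      intro k hk
      have h3 := (h2 k hk).self_of_nhds
      rw [cns_zero_zero, hcon k hk] at h3
      have : (k.factorial : ℝ) ≠ 0 := by positivity
      exact (mul_eq_zero.1 h3.symm).resolve_left this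
    let p : Polynomial ℝ := ∑ i ∈ Finset.range m, Polynomial.C (a i 0) * Polynomial.X ^ i +
      Polynomial.C (u 0) * Polynomial.X ^ m
    have hpc : ∀ i < m, p.coeff i = a i 0 := by
      intro i hi
      simp only [p, Polynomial.coeff_add, Polynomial.finsetSum_coeff,
        Polynomial.coeff_C_mul_X_pow]
      rw [if_neg hi.ne, add_zero, Finset.sum_ite_eq, if_pos (Finset.mem_range.2 hi)]
    have htc : Tendsto (fun t : ℝ => cns t (0 : Fin d → ℝ)) (𝓝 0) (𝓝 0) :=
      tendsto_cns tendsto_id tendsto_const_nhds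
    obtain ⟨i, hi, hi0⟩ := hai
    refine hi0 ?_
    rw [← hpc i hi]
    refine poly_aux m hm p ?_ (by rw [hpc _ (by omega), ham]) τ (fun t => w (cns t 0)) ?_ ?_ i hi
    · refine Polynomial.natDegree_add_le_of_degree_le ?_ (Polynomial.natDegree_C_mul_X_pow_le _ _)
      refine Polynomial.natDegree_sum_le_of_forall_le _ _ fun j hj => ?_
      exact (Polynomial.natDegree_C_mul_X_pow_le _ _).trans (Finset.mem_range.1 hj).le
    · have := hw.continuousAt.tendsto.comp htc
      simpa [ContinuousAt, Function.comp_def] using this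
    · filter_upwards [htc.eventually h1] with t ht
      simp only [F, tl_cns, cns_zero, φ, hγ0, zero_mul, cns_zero_zero] at ht
      rw [Finset.sum_eq_zero (s := Finset.range m) (f := fun i => b i 0 * t ^ i)
        (fun i hi => by rw [hb0 i (Finset.mem_range.1 hi), zero_mul]), zero_add] at ht
      rw [← ht]
      simp only [p, Polynomial.eval_add, Polynomial.eval_finsetSum, Polynomial.eval_mul,
        Polynomial.eval_C, Polynomial.eval_pow, Polynomial.eval_X]
      ring
  obtain ⟨k, hkm, hk0⟩ := hk
  have hmm : IsMono (mon γ) := ⟨γ, fun _ => 1, analyticAt_const, one_ne_zero, by simp⟩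
  refine (hP k hkm (fun y => c y * mon γ y ^ m) F (U.map s) (hca.mul ((analyticAt_mon γ 0).pow m))
    (hc.mul (hmm.pow m)).not_zero hF hk0 hch.le).congr ?_
  filter_upwards [hch.tendsto.eventually hf] with x hx
  rw [hx]
  have h1 : tl (φ x) = tl x := rfl
  have h2 : φ x 0 = mon γ (tl x) * (τ + x 0) := rfl
  rw [h1, h2, mul_assoc]
  congr 1
  simp only [F, mul_add, Finset.mul_sum]
  congr 1
  · refine Finset.sum_congr rfl fun i hi => ?_
    have : mon γ (tl x) ^ m = mon γ (tl x) ^ (m-i) * mon γ (tl x) ^ i := by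
      rw [← pow_add]; congr 1; have := Finset.mem_range.1 hi; omega
    rw [this, ← mul_add, mul_pow]; ring
  · rw [← mul_add, mul_pow]; ring

lemma core {d m : ℕ} (hm : 1 ≤ m) (hP : ∀ k < m, Pm d k) {γ : Fin d → ℕ} (hγ : γ ≠ 0)
    {a : ℕ → (Fin d → ℝ) → ℝ} {u f : (Fin (d+1) → ℝ) → ℝ} {c : (Fin d → ℝ) → ℝ}
    (ha : ∀ i, AnalyticAt ℝ (a i) 0) (ham : a (m-1) 0 = 0) (hai : ∃ i < m, a i 0 ≠ 0)
    (hu : AnalyticAt ℝ u 0) (hu0 : u 0 ≠ 0) (hc : IsMono c) (hca : AnalyticAt ℝ c 0)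
    (hf : ∀ᶠ x in 𝓝 (0 : Fin (d+1) → ℝ), f x = ∑ i ∈ Finset.range m,
      (mon γ (tl x)) ^ (m-i) * a i (tl x) * x 0 ^ i + x 0 ^ m * u x)
    {U : Ultrafilter (Fin (d+1) → ℝ)} (hU : (U : Filter (Fin (d+1) → ℝ)) ≤ 𝓝 0) :
    Mz (fun x => c (tl x) * f x) U := by
  by_cases h : ∃ M : ℝ, ∀ᶠ x in (U : Filter (Fin (d+1) → ℝ)), |x 0| ≤ M * |mon γ (tl x)|
  · obtain ⟨M, hM⟩ := h
    exact caseA hm hP hγ ha ham hai hu hc hca hf hU M hM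
  · push Not at h
    exact caseB ha hu hu0 hc hf hU h

/-- Monomialization in dimension `d`. -/
def MZ (d : ℕ) : Prop :=
  ∀ (f : (Fin d → ℝ) → ℝ) (U : Ultrafilter (Fin d → ℝ)), AnalyticAt ℝ f 0 →
    (¬ ∀ᶠ x in 𝓝 0, f x = 0) → (U : Filter (Fin d → ℝ)) ≤ 𝓝 0 → Mz f U

lemma IsMono.comp_tl {d : ℕ} {c : (Fin d → ℝ) → ℝ} (hc : IsMono c) :
    IsMono (fun x : Fin (d+1) → ℝ => c (tl x)) :=
  hc.comp (analyticAt_tl 0) rfl fun i => IsMono.coord i.succ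

lemma map_tl_le {d : ℕ} {U : Ultrafilter (Fin (d+1) → ℝ)}
    (hU : (U : Filter (Fin (d+1) → ℝ)) ≤ 𝓝 0) :
    ((U.map tl : Ultrafilter (Fin d → ℝ)) : Filter (Fin d → ℝ)) ≤ 𝓝 0 :=
  tendsto_tl.mono_left hU

lemma mz_tl_unit {d m : ℕ} (IH : MZ d) {c : (Fin d → ℝ) → ℝ} {f u : (Fin (d+1) → ℝ) → ℝ}
    {U : Ultrafilter (Fin (d+1) → ℝ)} (hc : AnalyticAt ℝ c 0) (hc0 : ¬ ∀ᶠ y in 𝓝 0, c y = 0)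
    (hu : AnalyticAt ℝ u 0) (hu0 : u 0 ≠ 0) (hf : ∀ᶠ x in 𝓝 0, f x = x 0 ^ m * u x)
    (hU : (U : Filter (Fin (d+1) → ℝ)) ≤ 𝓝 0) : Mz (fun x => c (tl x) * f x) U := by
  obtain ⟨φ, s, hch, hm⟩ := IH c (U.map tl) hc hc0 (map_tl_le hU)
  have hl := hch.lift hU
  refine ⟨_, _, hl, ?_⟩
  have h1 : IsMono (fun x : Fin (d+1) → ℝ => x 0 ^ m * u (cns (x 0) (φ (tl x)))) := by
    refine ((IsMono.coord 0).pow m).mul (IsMono.of_ne_zero ?_ ?_)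
    · exact AnalyticAt.fun_comp (g := u) (by rw [hl.zero]; exact hu) hl.an
    · have := hl.zero
      rwa [this]
  refine hm.comp_tl.mul (h1.congr ?_)
  filter_upwards [hl.tendsto.eventually hf] with x hx
  rw [hx]; rfl

lemma step3 {d m : ℕ} (hm : 1 ≤ m) (hP : ∀ k < m, Pm d k) (I : Finset ℕ) (hI : I.Nonempty)
    (hIm : ∀ i ∈ I, i < m) (hIm1 : m - 1 ∉ I)
    {b : ℕ → (Fin d → ℝ) → ℝ} {u f : (Fin (d+1) → ℝ) → ℝ} {c : (Fin d → ℝ) → ℝ}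
    (hb0 : ∀ i < m, b i 0 = 0)
    (hbI : ∀ i ∈ I, IsMono (b i)) (hbn : ∀ i < m, i ∉ I → ∀ᶠ y in 𝓝 0, b i y = 0)
    (hdiff : ∀ i ∈ I, ∀ j ∈ I, (∀ᶠ y in 𝓝 0, b i y ^ (m.factorial / (m-i)) -
        b j y ^ (m.factorial / (m-j)) = 0) ∨
      IsMono (fun y => b i y ^ (m.factorial / (m-i)) - b j y ^ (m.factorial / (m-j))))
    (hu : AnalyticAt ℝ u 0) (hu0 : u 0 ≠ 0) (hc : IsMono c) (hca : AnalyticAt ℝ c 0)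
    (hf : ∀ᶠ x in 𝓝 (0 : Fin (d+1) → ℝ), f x = ∑ i ∈ Finset.range m,
      b i (tl x) * x 0 ^ i + x 0 ^ m * u x)
    {U : Ultrafilter (Fin (d+1) → ℝ)} (hU : (U : Filter (Fin (d+1) → ℝ)) ≤ 𝓝 0) :
    Mz (fun x => c (tl x) * f x) U := by
  classical
  have h1 : ∀ i, ∃ (α : Fin d → ℕ) (v : (Fin d → ℝ) → ℝ), i ∈ I → AnalyticAt ℝ v 0 ∧ v 0 ≠ 0 ∧
      ∀ᶠ x in 𝓝 (0 : Fin d → ℝ), b i x = mon α x * v x := by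
    intro i
    by_cases hi : i ∈ I
    · obtain ⟨α, v, h⟩ := hbI i hi
      exact ⟨α, v, fun _ => h⟩
    · exact ⟨0, 0, fun h => absurd h hi⟩
  choose α v hv using h1
  let e : ℕ → ℕ := fun i => m.factorial / (m-i)
  have he : ∀ i < m, (m-i) * e i = m.factorial := fun i hi =>
    Nat.mul_div_cancel' (Nat.dvd_factorial (by omega) (by omega))
  have hN : m.factorial ≠ 0 := Nat.factorial_ne_zero m
  have hcmp : ∀ i ∈ I, ∀ j ∈ I, e i • α i ≤ e j • α j ∨ e j • α j ≤ e i • α i := by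
    intro i hi j hj
    obtain ⟨hvi, hvi0, hbi⟩ := hv i hi
    obtain ⟨hvj, hvj0, hbj⟩ := hv j hj
    refine mono_comparable _ _ (fun x => v i x ^ e i) (fun x => v j x ^ e j) (hvi.pow _) (hvj.pow _)
      (pow_ne_zero _ hvi0) (pow_ne_zero _ hvj0) ?_
    have heq : ∀ᶠ x in 𝓝 (0 : Fin d → ℝ), mon (e i • α i) x * v i x ^ e i -
        mon (e j • α j) x * v j x ^ e j = b i x ^ e i - b j x ^ e j := by
      filter_upwards [hbi, hbj] with x h1 h2
      rw [h1, h2, mon_nsmul, mon_nsmul, mul_pow, mul_pow]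
    rcases hdiff i hi j hj with h | h
    · left
      filter_upwards [heq, h] with x h1 h2
      rw [h1]; exact h2
    · right; exact h.congr heq
  obtain ⟨k, hk⟩ := I.exists_minimalFor (fun i => e i • α i) hI
  have hkI := hk.1
  have hkmin : ∀ j ∈ I, e k • α k ≤ e j • α j := fun j hj =>
    (hcmp k hkI j hj).elim _root_.id fun h => hk.2 hj h
  set γ := e k • α k with hγdef
  have hγ : γ ≠ 0 := by
    intro h0
    obtain ⟨-, hv0, hbk⟩ := hv k hkI
    have hek : e k ≠ 0 := by
      intro h; have := he k (hIm k hkI); rw [h, mul_zero] at this; exact hN this.symm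
    have hα : α k = 0 := (smul_eq_zero.1 h0).resolve_left hek
    have := hbk.self_of_nhds
    rw [hb0 k (hIm k hkI), hα, mon_zero, one_mul] at this
    exact hv0 this.symm
  obtain ⟨ε, s, hε, hch⟩ := power_chart (map_tl_le hU) hN
  set φ : (Fin d → ℝ) → (Fin d → ℝ) := fun z i => ε i * z i ^ m.factorial with hφ
  have hl := hch.lift hU
  refine Mz.of_chart hl ?_
  let a : ℕ → (Fin d → ℝ) → ℝ := fun i z => if i ∈ I then
    mon (α i) ε * mon ((m-i) • (e i • α i - γ)) z * v i (φ z) else 0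
  have hmonε : ∀ β, mon β ε ≠ 0 := fun β => mon_ne_zero fun i _ => hε i
  have ha : ∀ i, AnalyticAt ℝ (a i) 0 := by
    intro i
    by_cases hi : i ∈ I
    · simp only [a, if_pos hi]
      refine (analyticAt_const.mul (analyticAt_mon _ 0)).mul ?_
      exact AnalyticAt.fun_comp (g := v i) (by rw [hch.zero]; exact (hv i hi).1) hch.an
    · simp only [a, if_neg hi]; exact analyticAt_const
  have hba : ∀ i < m, ∀ᶠ z in 𝓝 (0 : Fin d → ℝ), b i (φ z) = mon γ z ^ (m-i) * a i z := by
    intro i him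
    by_cases hi : i ∈ I
    · filter_upwards [hch.tendsto.eventually (hv i hi).2.2] with z hz
      rw [hz]
      simp only [a, if_pos hi]
      have h2 : m.factorial • α i = (m-i) • γ + (m-i) • (e i • α i - γ) := by
        rw [← smul_add, add_tsub_cancel_of_le (hkmin i hi), smul_smul, he i him]
      rw [hφ, mon_power, h2, mon_add, ← mon_nsmul (m-i) γ]
      ring
    · filter_upwards [hch.tendsto.eventually (hbn i him hi)] with z hz
      rw [hz]; simp [a, hi]
  refine core hm hP hγ ha (by simp [a, hIm1]) ⟨k, hIm k hkI, ?_⟩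
    (u := fun x => u (cns (x 0) (φ (tl x)))) (c := fun y => c (φ y)) ?_ ?_ ?_ ?_ ?_ hl.le
  · simp only [a, if_pos hkI]
    have h3 : e k • α k - γ = 0 := by rw [hγdef]; exact tsub_self _
    rw [h3, smul_zero, mon_zero, mul_one, hch.zero]
    exact mul_ne_zero (hmonε _) (hv k hkI).2.1
  · exact AnalyticAt.fun_comp (g := u) (by rw [hl.zero]; exact hu) hl.an
  · have := hl.zero
    rwa [this]
  · refine hc.comp hch.an hch.zero fun i => ?_
    exact (IsMono.of_ne_zero analyticAt_const (hε i)).mul ((IsMono.coord i).pow _)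
  · exact AnalyticAt.fun_comp (g := c) (by rw [hch.zero]; exact hca) hch.an
  · have h4 : ∀ᶠ x in 𝓝 (0 : Fin (d+1) → ℝ), ∀ i ∈ Finset.range m,
        b i (φ (tl x)) = mon γ (tl x) ^ (m-i) * a i (tl x) := by
      rw [Filter.eventually_all_finset]
      intro i hi
      exact tendsto_tl.eventually (hba i (Finset.mem_range.1 hi))
    filter_upwards [hl.tendsto.eventually hf, h4] with x hx h4
    rw [hx]
    simp only [tl_cns, cns_zero]
    congr 1
    refine Finset.sum_congr rfl fun i hi => ?_
    rw [h4 i hi]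

lemma step2 {d m : ℕ} (IH : MZ d) (hm : 1 ≤ m) (hP : ∀ k < m, Pm d k)
    {a : ℕ → (Fin d → ℝ) → ℝ} {u f : (Fin (d+1) → ℝ) → ℝ} {c : (Fin d → ℝ) → ℝ}
    (ha : ∀ i, AnalyticAt ℝ (a i) 0) (ha0 : ∀ i < m, a i 0 = 0)
    (ham : ∀ᶠ y in 𝓝 0, a (m-1) y = 0)
    (hu : AnalyticAt ℝ u 0) (hu0 : u 0 ≠ 0) (hc : AnalyticAt ℝ c 0)
    (hc0 : ¬ ∀ᶠ y in 𝓝 0, c y = 0)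
    (hf : ∀ᶠ x in 𝓝 (0 : Fin (d+1) → ℝ), f x = ∑ i ∈ Finset.range m,
      a i (tl x) * x 0 ^ i + x 0 ^ m * u x)
    {U : Ultrafilter (Fin (d+1) → ℝ)} (hU : (U : Filter (Fin (d+1) → ℝ)) ≤ 𝓝 0) :
    Mz (fun x => c (tl x) * f x) U := by
  classical
  let I : Finset ℕ := (Finset.range m).filter fun i => ¬ ∀ᶠ y in 𝓝 0, a i y = 0
  have hIm : ∀ i ∈ I, i < m := fun i hi => Finset.mem_range.1 (Finset.mem_filter.1 hi).1
  have hIn : ∀ i ∈ I, ¬ ∀ᶠ y in 𝓝 0, a i y = 0 := fun i hi => (Finset.mem_filter.1 hi).2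
  have hnI : ∀ i < m, i ∉ I → ∀ᶠ y in 𝓝 0, a i y = 0 := by
    intro i him hi
    by_contra hcon
    exact hi (Finset.mem_filter.2 ⟨Finset.mem_range.2 him, hcon⟩)
  rcases I.eq_empty_or_nonempty with hI | hI
  · refine mz_tl_unit IH hc hc0 hu hu0 (m := m) ?_ hU
    have h4 : ∀ᶠ x in 𝓝 (0 : Fin (d+1) → ℝ), ∀ i ∈ Finset.range m, a i (tl x) = 0 := by
      rw [Filter.eventually_all_finset]
      intro i hi
      exact tendsto_tl.eventually (hnI i (Finset.mem_range.1 hi) (by rw [hI]; simp))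
    filter_upwards [hf, h4] with x hx h4
    rw [hx, Finset.sum_eq_zero fun i hi => by rw [h4 i hi, zero_mul], zero_add]
  · let D : ℕ × ℕ → (Fin d → ℝ) → ℝ := fun p y =>
      a p.1 y ^ (m.factorial / (m-p.1)) - a p.2 y ^ (m.factorial / (m-p.2))
    let T := (I ×ˢ I).filter fun p => ¬ ∀ᶠ y in 𝓝 0, D p y = 0
    have hD : ∀ p, AnalyticAt ℝ (D p) 0 := fun p => ((ha _).pow _).sub ((ha _).pow _)
    let H1 : (Fin d → ℝ) → ℝ := fun y => ∏ i ∈ I, a i y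
    let H2 : (Fin d → ℝ) → ℝ := fun y => ∏ p ∈ T, D p y
    have hH1 : AnalyticAt ℝ H1 0 := analyticAt_finset_prod _ _ _ fun i _ => ha i
    have hH2 : AnalyticAt ℝ H2 0 := analyticAt_finset_prod _ _ _ fun i _ => hD i
    have hH1n : ¬ ∀ᶠ y in 𝓝 0, H1 y = 0 := germ_prod_ne_zero _ _ _ (fun i _ => ha i) hIn
    have hH2n : ¬ ∀ᶠ y in 𝓝 0, H2 y = 0 :=
      germ_prod_ne_zero _ _ _ (fun i _ => hD i) fun p hp => (Finset.mem_filter.1 hp).2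
    have hHn : ¬ ∀ᶠ y in 𝓝 0, c y * (H1 y * H2 y) = 0 := by
      intro h
      rcases germ_mul_eq_zero hc (hH1.mul hH2) h with h | h
      · exact hc0 h
      · exact (germ_mul_eq_zero hH1 hH2 h).elim hH1n hH2n
    obtain ⟨φ, s, hch, hmono⟩ := IH (fun y => c y * (H1 y * H2 y)) (U.map tl)
      (hc.mul (hH1.mul hH2)) hHn (map_tl_le hU)
    have hcomp : ∀ g : (Fin d → ℝ) → ℝ, AnalyticAt ℝ g 0 → AnalyticAt ℝ (fun y => g (φ y)) 0 :=
      fun g hg => AnalyticAt.fun_comp (g := g) (by rw [hch.zero]; exact hg) hch.an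
    have hm1 : IsMono (fun y => c (φ y)) :=
      IsMono.of_mul (hcomp c hc) (hcomp _ (hH1.mul hH2)) hmono
    have hm2 : IsMono (fun y => H1 (φ y) * H2 (φ y)) :=
      IsMono.of_mul (hcomp _ (hH1.mul hH2)) (hcomp c hc)
        (hmono.congr (Eventually.of_forall fun x => mul_comm _ _))
    have hm3 : IsMono (fun y => H1 (φ y)) := IsMono.of_mul (hcomp _ hH1) (hcomp _ hH2) hm2
    have hm4 : IsMono (fun y => H2 (φ y)) := IsMono.of_mul (hcomp _ hH2) (hcomp _ hH1)
        (hm2.congr (Eventually.of_forall fun x => mul_comm _ _))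
    have hl := hch.lift hU
    refine Mz.of_chart hl ?_
    refine step3 hm hP I hI hIm ?_ (b := fun i y => a i (φ y))
      (u := fun x => u (cns (x 0) (φ (tl x)))) (c := fun y => c (φ y)) ?_ ?_ ?_ ?_ ?_ ?_ hm1
        (hcomp c hc) ?_ hl.le
    · intro h; exact hIn _ h ham
    · intro i hi; simp only [hch.zero]; exact ha0 i hi
    · exact IsMono.of_prod I (fun i y => a i (φ y)) (fun i _ => hcomp _ (ha i)) hm3
    · intro i him hi; exact hch.tendsto.eventually (hnI i him hi)
    · intro i hi j hj
      by_cases hp : (i, j) ∈ T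
      · right
        exact IsMono.of_prod T (fun p y => D p (φ y)) (fun p _ => hcomp _ (hD p)) hm4 _ hp
      · left
        have : ∀ᶠ y in 𝓝 0, D (i, j) y = 0 := by
          by_contra hcon
          exact hp (Finset.mem_filter.2 ⟨Finset.mem_product.2 ⟨hi, hj⟩, hcon⟩)
        exact hch.tendsto.eventually this
    · exact AnalyticAt.fun_comp (g := u) (by rw [hl.zero]; exact hu) hl.an
    · have := hl.zero
      rwa [this]
    · filter_upwards [hl.tendsto.eventually hf] with x hx
      rw [hx]; rfl

lemma Pm_step {d : ℕ} (IH : MZ d) (m : ℕ) (hP : ∀ k < m, Pm d k) : Pm d m := by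
  intro c f U hc hc0 hf hfm hU
  by_cases hlow : ∃ k < m, D0^[k] f 0 ≠ 0
  · obtain ⟨k, hk, hk0⟩ := hlow
    exact hP k hk c f U hc hc0 hf hk0 hU
  push Not at hlow
  rcases Nat.eq_zero_or_pos m with rfl | hm
  · exact mz_tl_unit IH hc hc0 hf hfm (m := 0) (by simp) hU
  obtain ⟨g, hg, hg0, hgG⟩ := implicit0 (D0_iter_analytic hf (m-1)) (hlow (m-1) (by omega)) (by
    have := hfm
    rw [show m = (m-1)+1 by omega, Function.iterate_succ_apply'] at this
    exact this)
  have hch : Chart (shear g) (fun x => cns (x 0 - g (tl x)) (tl x)) U := by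
    refine ⟨shear_analytic hg, shear_zero hg0, Eventually.of_forall fun x => ?_, ?_⟩
    · simp [shear]
    · refine tendsto_cns ?_ (tendsto_tl.mono_left hU)
      have h1 : Tendsto (fun x : Fin (d+1) → ℝ => g (tl x)) (𝓝 0) (𝓝 0) := by
        have := hg.comp_tl.continuousAt.tendsto
        simpa [hg0] using this
      simpa using ((tendsto_coord 0).sub h1).mono_left hU
  refine Mz.of_chart hch ?_
  let f1 : (Fin (d+1) → ℝ) → ℝ := fun x => f (shear g x)
  have hf1 : AnalyticAt ℝ f1 0 :=
    AnalyticAt.fun_comp (g := f) (by rw [hch.zero]; exact hf) hch.an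
  have hk1 : ∀ k, D0^[k] f1 0 = D0^[k] f 0 := by
    intro k
    have := (D0_iter_shear hg hg0 hf k).self_of_nhds
    simp only [shear_zero hg0] at this
    exact this
  obtain ⟨a, u, ha, hu, h1, h2, h3⟩ := taylor0 m hf1
  have hfac : ∀ k : ℕ, (k.factorial : ℝ) ≠ 0 := fun k => by positivity
  refine step2 IH hm hP ha ?_ ?_ hu ?_ hc hc0 h1 hch.le
  · intro i hi
    have := (h2 i hi).self_of_nhds
    rw [cns_zero_zero, hk1, hlow i hi] at this
    exact (mul_eq_zero.1 this.symm).resolve_left (hfac i)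
  · filter_upwards [h2 (m-1) (by omega), hgG,
      tendsto_cns0.eventually (D0_iter_shear hg hg0 hf (m-1))] with y h4 h5 h6
    have h7 : shear g (cns 0 y) = cns (g y) y := by simp [shear]
    rw [h7, h5] at h6
    have h8 : D0^[m-1] f1 (cns 0 y) = 0 := h6
    rw [h8] at h4
    exact (mul_eq_zero.1 h4.symm).resolve_left (hfac _)
  · intro h
    rw [h, mul_zero, hk1] at h3
    exact hfm h3

lemma Pm_all {d : ℕ} (IH : MZ d) (m : ℕ) : Pm d m := by
  induction m using Nat.strong_induction_on with
  | _ m ih => exact Pm_step IH m ih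

lemma exists_direction {d : ℕ} {f : (Fin d → ℝ) → ℝ} (hf : AnalyticAt ℝ f 0)
    (hn : ¬ ∀ᶠ x in 𝓝 0, f x = 0) : ∃ v : Fin d → ℝ, ¬ ∀ᶠ t in 𝓝 (0:ℝ), f (t • v) = 0 := by
  by_contra hcon
  push Not at hcon
  obtain ⟨r, hr, hb⟩ := Metric.eventually_nhds_iff_ball.1 hf.eventually_analyticAt
  apply hn
  filter_upwards [Metric.ball_mem_nhds (0 : Fin d → ℝ) hr] with x hx
  have hx' : ‖x‖ < r := by simpa using hx
  have han : AnalyticOnNhd ℝ (fun t : ℝ => f (t • x)) (Icc 0 1) := by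
    intro t ht
    have hmem : t • x ∈ Metric.ball (0 : Fin d → ℝ) r := by
      rw [mem_ball_zero_iff, norm_smul, Real.norm_eq_abs, abs_of_nonneg ht.1]
      have := mul_le_mul_of_nonneg_right ht.2 (norm_nonneg x)
      linarith
    have h1 : AnalyticAt ℝ (fun t : ℝ => t • x) t := analyticAt_id.smul analyticAt_const
    exact AnalyticAt.fun_comp (g := f) (hb _ hmem) h1
  have h2 := han.eqOn_zero_of_preconnected_of_eventuallyEq_zero isPreconnected_Icc
    (z₀ := 0) (by simp) (hcon x)
  have := h2 (x := 1) (by simp)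
  simpa using this

lemma exists_order {d : ℕ} {f : (Fin (d+1) → ℝ) → ℝ} (hf : AnalyticAt ℝ f 0)
    (hn : ¬ ∀ᶠ t in 𝓝 (0:ℝ), f (t • e0) = 0) : ∃ m, D0^[m] f 0 ≠ 0 := by
  by_contra hcon
  push Not at hcon
  have hce : ∀ t : ℝ, t • (e0 : Fin (d+1) → ℝ) = cns t 0 := by
    intro t
    refine cns_ext (by simp [e0]) ?_
    funext i; simp [e0]
  simp only [hce] at hn
  have htc : Tendsto (fun t : ℝ => cns t (0 : Fin d → ℝ)) (𝓝 0) (𝓝 0) :=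
      tendsto_cns tendsto_id tendsto_const_nhds
  have hca : AnalyticAt ℝ (fun t : ℝ => cns t (0 : Fin d → ℝ)) 0 :=
    analyticAt_cns analyticAt_id analyticAt_const
  have hg : AnalyticAt ℝ (fun t : ℝ => f (cns t 0)) 0 :=
    AnalyticAt.fun_comp (g := f) (by simpa using hf) hca
  obtain ⟨n, h, hh, hh0, hgh⟩ := hg.exists_eventuallyEq_pow_smul_nonzero_iff.2 hn
  obtain ⟨a, u, ha, hu, h1, h2, -⟩ := taylor0 (n+1) hf
  have ha0 : ∀ k < n+1, a k 0 = 0 := by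
    intro k hk
    have h3 := (h2 k hk).self_of_nhds
    rw [cns_zero_zero, hcon k] at h3
    have : (k.factorial : ℝ) ≠ 0 := by positivity
    exact (mul_eq_zero.1 h3.symm).resolve_left this
  have h4 : ∀ᶠ t in 𝓝[≠] (0:ℝ), t * u (cns t 0) = h t := by
    filter_upwards [hgh.filter_mono nhdsWithin_le_nhds,
      (htc.eventually h1).filter_mono nhdsWithin_le_nhds, self_mem_nhdsWithin] with t h5 h6 h7
    have h7' : t ≠ 0 := h7
    rw [h5] at h6
    simp only [tl_cns, cns_zero, sub_zero, smul_eq_mul] at h6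
    rw [Finset.sum_eq_zero fun i hi => by rw [ha0 i (Finset.mem_range.1 hi), zero_mul], zero_add,
      pow_succ, mul_assoc] at h6
    exact (mul_left_cancel₀ (pow_ne_zero _ h7') h6).symm
  have h5 : Tendsto h (𝓝[≠] 0) (𝓝 (h 0)) := hh.continuousAt.tendsto.mono_left nhdsWithin_le_nhds
  have h6 : Tendsto (fun t : ℝ => t * u (cns t 0)) (𝓝[≠] 0) (𝓝 0) := by
    have hua : AnalyticAt ℝ (fun t : ℝ => t * u (cns t 0)) 0 :=
      analyticAt_id.mul (AnalyticAt.fun_comp (g := u) (by simpa using hu) hca)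
    have := hua.continuousAt.tendsto.mono_left (nhdsWithin_le_nhds (s := {0}ᶜ))
    simpa using this
  exact hh0 (tendsto_nhds_unique h5 (h6.congr' h4))

/-- Local monomialization of analytic germs along ultrafilters. -/
theorem monomialization (d : ℕ) : MZ d := by
  induction d with
  | zero =>
    intro f U hf hn hU
    refine ⟨_, _, Chart.id hU, IsMono.of_ne_zero hf fun h => hn ?_⟩
    exact Eventually.of_forall fun x => by rw [Subsingleton.elim x 0, h]
  | succ d ih =>
    intro f U hf hn hU
    have key : ∀ (f : (Fin (d+1) → ℝ) → ℝ) (U : Ultrafilter (Fin (d+1) → ℝ)), AnalyticAt ℝ f 0 →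
        (U : Filter (Fin (d+1) → ℝ)) ≤ 𝓝 0 → (∃ m, D0^[m] f 0 ≠ 0) → Mz f U := by
      rintro f U hf hU ⟨m, hm⟩
      have := Pm_all ih m (fun _ => 1) f U analyticAt_const
        (fun h => one_ne_zero h.self_of_nhds) hf hm hU
      simpa using this
    obtain ⟨v, hv⟩ := exists_direction hf hn
    by_cases hv0 : v = 0
    · refine key f U hf hU ⟨0, fun h => hv ?_⟩
      subst hv0
      simpa using h
    · have he0 : (e0 : Fin (d+1) → ℝ) ≠ 0 := by
        intro h
        have := congrFun h 0
        simp [e0] at this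
      obtain ⟨L, hL⟩ := SeparatingDual.exists_continuousLinearEquiv_apply_eq (R := ℝ) he0 hv0
      have hch : Chart L L.symm U := by
        refine ⟨L.analyticAt 0, map_zero L, Eventually.of_forall fun x => L.apply_symm_apply x, ?_⟩
        have := L.symm.continuous.tendsto 0
        rw [map_zero] at this
        exact this.mono_left hU
      refine Mz.of_chart hch (key _ _ ?_ hch.le (exists_order ?_ ?_))
      · exact AnalyticAt.fun_comp (g := f) (by rw [hch.zero]; exact hf) hch.an
      · exact AnalyticAt.fun_comp (g := f) (by rw [hch.zero]; exact hf) hch.an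
      · simpa [hL] using hv

lemma mon_update {d : ℕ} (α : Fin d → ℕ) (z : Fin d → ℝ) (i : Fin d) (t : ℝ) :
    mon α (Function.update z i (t * z i)) = t ^ α i * mon α z := by
  rw [mon_split α i, mon_split α i z, Function.update_self, mul_pow, mul_assoc]
  congr 2
  refine Finset.prod_congr rfl fun j hj => ?_
  rw [Function.update_of_ne (Finset.ne_of_mem_erase hj)]

lemma same_sign {d : ℕ} {w : (Fin d → ℝ) → ℝ} (hw : AnalyticAt ℝ w 0) (h0 : w 0 ≠ 0) :
    ∀ᶠ x in 𝓝 (0 : Fin d → ℝ), 0 < w x * w 0 := by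
  have h1 : ContinuousAt (fun x => w x * w 0) 0 := hw.continuousAt.mul continuousAt_const
  exact h1.eventually (lt_mem_nhds (mul_self_pos.2 h0))

lemma mono_local {d : ℕ} {E : Type*} [NormedAddCommGroup E] [NormedSpace ℝ E]
    [CompleteSpace E]
    (K Z : Set E) (hK : IsClosed K) {q : ℕ} (f g : Fin q → (Fin d → ℝ) → ℝ)
    (h : (Fin d → ℝ) → ℝ) (π : (Fin d → ℝ) → E) (hπ : AnalyticAt ℝ π 0)
    (hf : ∀ j, (∀ᶠ x in 𝓝 0, f j x = 0) ∨ IsMono (f j)) (hg : ∀ j, IsMono (g j))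
    (hh : IsMono h) (hh0 : h 0 = 0)
    (hS : ∀ᶠ x in 𝓝 0, (∀ j, f j x = 0 ∧ 0 < g j x) → π x ∈ K)
    (hZ : ∀ᶠ x in 𝓝 0, π x ∈ K → h x = 0 → π x ∈ Z) :
    ∃ (N : ℕ) (C : ℝ), ∀ᶠ x in 𝓝 (0 : Fin d → ℝ), (∀ j, f j x = 0 ∧ 0 < g j x) →
      Metric.infDist (π x) Z ^ N ≤ C * |h x| := by
  obtain ⟨β, w, hw, hw0, hhw⟩ := hh
  have hβ : β ≠ 0 := by
    rintro rfl
    have := hhw.self_of_nhds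
    rw [mon_zero, one_mul, hh0] at this
    exact hw0 this.symm
  obtain ⟨L, s, hs, hL⟩ := hπ.hasStrictFDerivAt.exists_lipschitzOnWith
  have hgood : ∃ r > 0, ∀ x ∈ Metric.ball (0 : Fin d → ℝ) r, x ∈ s ∧ AnalyticAt ℝ π x ∧
      h x = mon β x * w x ∧ |w 0| / 2 < |w x| ∧
      ((∀ j, f j x = 0 ∧ 0 < g j x) → π x ∈ K) ∧ (π x ∈ K → h x = 0 → π x ∈ Z) ∧
      ∀ y ∈ Metric.ball (0 : Fin d → ℝ) r, ∀ i t, 0 < t → y = Function.update x i (t * x i) →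
        (∀ j, f j x = 0 ∧ 0 < g j x) → (∀ j, f j y = 0 ∧ 0 < g j y) := by
    have h1 : ∀ j, ∃ r > 0, ∀ x ∈ Metric.ball (0 : Fin d → ℝ) r,
        ∀ y ∈ Metric.ball (0 : Fin d → ℝ) r, ∀ i t, 0 < t → y = Function.update x i (t * x i) →
        (f j x = 0 ∧ 0 < g j x) → (f j y = 0 ∧ 0 < g j y) := by
      intro j
      have hfj : ∃ r > 0, ∀ x ∈ Metric.ball (0 : Fin d → ℝ) r,
          ∀ y ∈ Metric.ball (0 : Fin d → ℝ) r, ∀ i t, 0 < t → y = Function.update x i (t * x i) →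
          f j x = 0 → f j y = 0 := by
        rcases hf j with hz | ⟨α, v, hv, hv0, hfv⟩
        · obtain ⟨r, hr, hb⟩ := Metric.eventually_nhds_iff_ball.1 hz
          exact ⟨r, hr, fun x hx y hy i t ht hxy _ => hb y hy⟩
        · obtain ⟨r, hr, hb⟩ := Metric.eventually_nhds_iff_ball.1
            (hfv.and (hv.continuousAt.eventually_ne hv0))
          refine ⟨r, hr, fun x hx y hy i t ht hxy h0 => ?_⟩
          rw [(hb x hx).1] at h0
          have := (mul_eq_zero.1 h0).resolve_right (hb x hx).2
          rw [(hb y hy).1, hxy, mon_update, this]; simp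
      have hgj : ∃ r > 0, ∀ x ∈ Metric.ball (0 : Fin d → ℝ) r,
          ∀ y ∈ Metric.ball (0 : Fin d → ℝ) r, ∀ i t, 0 < t → y = Function.update x i (t * x i) →
          0 < g j x → 0 < g j y := by
        obtain ⟨α, v, hv, hv0, hgv⟩ := hg j
        obtain ⟨r, hr, hb⟩ := Metric.eventually_nhds_iff_ball.1 (hgv.and (same_sign hv hv0))
        refine ⟨r, hr, fun x hx y hy i t ht hxy h0 => ?_⟩
        have h1 := (hb x hx).2
        have h2 := (hb y hy).2
        rw [(hb x hx).1] at h0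
        rw [(hb y hy).1]
        have h3 : mon α y = t ^ α i * mon α x := by rw [hxy, mon_update]
        rw [h3, mul_assoc]
        refine mul_pos (pow_pos ht _) ?_
        have h4 : 0 < (mon α x * v y) * (v x * v x * (v 0 * v 0)) := by
          have := mul_pos h0 (mul_pos h1 h2)
          calc 0 < _ := this
            _ = _ := by ring
        have h5 : 0 ≤ v x * v x * (v 0 * v 0) :=
          mul_nonneg (mul_self_nonneg _) (mul_self_nonneg _)
        exact pos_of_mul_pos_left h4 h5
      obtain ⟨r1, hr1, hb1⟩ := hfj
      obtain ⟨r2, hr2, hb2⟩ := hgj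
      refine ⟨min r1 r2, lt_min hr1 hr2, fun x hx y hy i t ht hxy h0 => ?_⟩
      have e1 := Metric.ball_subset_ball (x := (0 : Fin d → ℝ)) (min_le_left r1 r2)
      have e2 := Metric.ball_subset_ball (x := (0 : Fin d → ℝ)) (min_le_right r1 r2)
      exact ⟨hb1 x (e1 hx) y (e1 hy) i t ht hxy h0.1, hb2 x (e2 hx) y (e2 hy) i t ht hxy h0.2⟩
    choose ρ hρ hρb using h1
    have hwc : ∀ᶠ x in 𝓝 (0 : Fin d → ℝ), |w 0| / 2 < |w x| := by
      have := hw.continuousAt.abs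
      exact this.eventually (lt_mem_nhds (half_lt_self (abs_pos.2 hw0)))
    have hρe : ∀ᶠ x in 𝓝 (0 : Fin d → ℝ), ∀ j, x ∈ Metric.ball (0 : Fin d → ℝ) (ρ j) :=
      eventually_all.2 fun j => Metric.ball_mem_nhds _ (hρ j)
    obtain ⟨r, hr, hb⟩ := Metric.eventually_nhds_iff_ball.1
      ((eventually_mem_set.2 hs).and (hπ.eventually_analyticAt.and (hhw.and
        (hwc.and (hS.and (hZ.and hρe))))))
    refine ⟨r, hr, fun x hx => ?_⟩
    obtain ⟨b1, b2, b3, b4, b5, b6, b7⟩ := hb x hx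
    refine ⟨b1, b2, b3, b4, b5, b6, fun y hy i t ht hxy h0 j => ?_⟩
    exact hρb j x (b7 j) y ((hb y hy).2.2.2.2.2.2 j) i t ht hxy (h0 j)
  obtain ⟨r, hr, hb⟩ := hgood
  refine ⟨∑ i, β i, (L : ℝ) ^ (∑ i, β i) * (2 / |w 0|), ?_⟩
  filter_upwards [Metric.ball_mem_nhds (0 : Fin d → ℝ) hr] with x hx hxS
  obtain ⟨b1, b2, b3, b4, b5, b6, b7⟩ := hb x hx
  obtain ⟨k, hk⟩ := Function.ne_iff.1 hβ
  obtain ⟨i, hi, himin⟩ := Finset.exists_min_image (Finset.univ.filter fun i => β i ≠ 0)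
    (fun i => |x i|) ⟨k, by simpa using hk⟩
  have hiβ : β i ≠ 0 := (Finset.mem_filter.1 hi).2
  have hball : ∀ t : ℝ, 0 ≤ t → t ≤ 1 →
      Function.update x i (t * x i) ∈ Metric.ball (0 : Fin d → ℝ) r := by
    intro t ht0 ht1
    rw [mem_ball_zero_iff] at hx ⊢
    refine lt_of_le_of_lt ((pi_norm_le_iff_of_nonneg (norm_nonneg x)).2 fun j => ?_) hx
    by_cases hj : j = i
    · subst hj
      rw [Function.update_self, norm_mul, Real.norm_eq_abs, abs_of_nonneg ht0]
      have := norm_le_pi_norm x j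
      have h2 := mul_le_mul_of_nonneg_right ht1 (norm_nonneg (x j))
      linarith
    · rw [Function.update_of_ne hj]; exact norm_le_pi_norm x j
  set y : Fin d → ℝ := Function.update x i (0 * x i) with hy
  have hyb := hball 0 le_rfl zero_le_one
  obtain ⟨y1, y2, y3, y4, y5, y6, -⟩ := hb y hyb
  have hyK : π y ∈ K := by
    have h1 : Tendsto (fun t : ℝ => Function.update x i (t * x i)) (𝓝[>] 0) (𝓝 y) := by
      have : Continuous (fun t : ℝ => Function.update x i (t * x i)) :=
        continuous_const.update i (continuous_id.mul continuous_const)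
      exact (this.tendsto 0).mono_left nhdsWithin_le_nhds
    refine hK.mem_of_tendsto (y2.continuousAt.tendsto.comp h1) ?_
    filter_upwards [Ioc_mem_nhdsGT (zero_lt_one' ℝ)] with t ht
    have hm := hball t ht.1.le ht.2
    exact (hb _ hm).2.2.2.2.1 (b7 _ hm i t ht.1 rfl hxS)
  have hyZ : π y ∈ Z := by
    refine y6 hyK ?_
    rw [y3, hy, mon_update, zero_pow hiβ]; simp
  have hd : Metric.infDist (π x) Z ≤ L * |x i| := by
    refine (Metric.infDist_le_dist_of_mem hyZ).trans ((hL.dist_le_mul x b1 y y1).trans ?_)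
    refine mul_le_mul_of_nonneg_left ?_ L.2
    refine (dist_pi_le_iff (abs_nonneg _)).2 fun j => ?_
    by_cases hj : j = i
    · subst hj; rw [hy, Function.update_self, Real.dist_eq]; simp
    · rw [hy, Function.update_of_ne hj, dist_self]; exact abs_nonneg _
  have hmon : |x i| ^ (∑ i, β i) ≤ |mon β x| := by
    rw [mon, Finset.abs_prod, ← Finset.prod_pow_eq_pow_sum]
    refine Finset.prod_le_prod (fun j _ => by positivity) fun j _ => ?_
    rw [abs_pow]
    by_cases hj : β j = 0
    · simp [hj]
    · exact pow_le_pow_left₀ (abs_nonneg _) (himin j (by simpa using hj)) _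
  have hw0' : 0 < |w 0| := abs_pos.2 hw0
  calc Metric.infDist (π x) Z ^ (∑ i, β i) ≤ (L * |x i|) ^ (∑ i, β i) :=
        pow_le_pow_left₀ Metric.infDist_nonneg hd _
    _ = (L:ℝ) ^ (∑ i, β i) * |x i| ^ (∑ i, β i) := mul_pow _ _ _
    _ ≤ (L:ℝ) ^ (∑ i, β i) * |mon β x| := by gcongr
    _ ≤ (L:ℝ) ^ (∑ i, β i) * (|mon β x| * (|w x| * (2 / |w 0|))) := by
        have : 1 ≤ |w x| * (2 / |w 0|) := by
          rw [mul_div_assoc', le_div_iff₀ hw0']; linarith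
        gcongr
        exact le_mul_of_one_le_right (abs_nonneg _) this
    _ = _ := by rw [b3, abs_mul]; ring

lemma ultra_local {d : ℕ} {E : Type*} [NormedAddCommGroup E] [NormedSpace ℝ E]
    [CompleteSpace E]
    (K Z : Set E) (hK : IsClosed K) {q : ℕ} (f g : Fin q → (Fin d → ℝ) → ℝ)
    (h : (Fin d → ℝ) → ℝ) (π : (Fin d → ℝ) → E) (hπ : AnalyticAt ℝ π 0)
    (hf : ∀ j, AnalyticAt ℝ (f j) 0) (hg : ∀ j, AnalyticAt ℝ (g j) 0)
    (hh : AnalyticAt ℝ h 0) (hh0 : h 0 = 0)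
    (hS : ∀ᶠ x in 𝓝 0, (∀ j, f j x = 0 ∧ 0 < g j x) → π x ∈ K)
    (hZ : ∀ᶠ x in 𝓝 0, π x ∈ K → h x = 0 → π x ∈ Z)
    (U : Ultrafilter (Fin d → ℝ)) (hU : (U : Filter (Fin d → ℝ)) ≤ 𝓝 0)
    (hUS : ∀ᶠ x in (U : Filter (Fin d → ℝ)), ∀ j, f j x = 0 ∧ 0 < g j x) :
    ∃ (N : ℕ) (C : ℝ), ∀ᶠ x in (U : Filter (Fin d → ℝ)),
      Metric.infDist (π x) Z ^ N ≤ C * |h x| := by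
  classical
  by_cases hhz : ∀ᶠ x in 𝓝 0, h x = 0
  · refine ⟨1, 0, ?_⟩
    filter_upwards [hU hhz, hUS, hU hS, hU hZ] with x h1 h2 h3 h4
    rw [Metric.infDist_zero_of_mem (h4 (h3 h2) h1)]; simp
  let T : Finset (Fin q) := Finset.univ.filter fun j => ¬ ∀ᶠ x in 𝓝 0, f j x = 0
  let H1 : (Fin d → ℝ) → ℝ := fun y => ∏ j ∈ T, f j y
  let H2 : (Fin d → ℝ) → ℝ := fun y => ∏ j, g j y
  have hH1 : AnalyticAt ℝ H1 0 := analyticAt_finset_prod _ _ _ fun i _ => hf i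
  have hH2 : AnalyticAt ℝ H2 0 := analyticAt_finset_prod _ _ _ fun i _ => hg i
  have hH1n : ¬ ∀ᶠ y in 𝓝 0, H1 y = 0 :=
    germ_prod_ne_zero _ _ _ (fun i _ => hf i) fun j hj => (Finset.mem_filter.1 hj).2
  have hH2n : ¬ ∀ᶠ y in 𝓝 0, H2 y = 0 := by
    refine germ_prod_ne_zero _ _ _ (fun i _ => hg i) fun j hj hz => ?_
    obtain ⟨x, h1, h2⟩ := ((hz.filter_mono hU).and hUS).exists
    have h1' : g j x = 0 := h1
    have := (h2 j).2
    rw [h1'] at this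
    exact lt_irrefl _ this
  have hHn : ¬ ∀ᶠ y in 𝓝 0, h y * (H1 y * H2 y) = 0 := by
    intro hz
    rcases germ_mul_eq_zero hh (hH1.mul hH2) hz with hz | hz
    · exact hhz hz
    · exact (germ_mul_eq_zero hH1 hH2 hz).elim hH1n hH2n
  obtain ⟨φ, s, hch, hmono⟩ := monomialization d (fun y => h y * (H1 y * H2 y)) U
    (hh.mul (hH1.mul hH2)) hHn hU
  have hcomp : ∀ g : (Fin d → ℝ) → ℝ, AnalyticAt ℝ g 0 → AnalyticAt ℝ (fun y => g (φ y)) 0 :=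
    fun g hg => AnalyticAt.fun_comp (g := g) (by rw [hch.zero]; exact hg) hch.an
  have hm1 : IsMono (fun y => h (φ y)) :=
    IsMono.of_mul (hcomp h hh) (hcomp _ (hH1.mul hH2)) hmono
  have hm2 : IsMono (fun y => H1 (φ y) * H2 (φ y)) :=
    IsMono.of_mul (hcomp _ (hH1.mul hH2)) (hcomp h hh)
      (hmono.congr (Eventually.of_forall fun x => mul_comm _ _))
  have hm3 : IsMono (fun y => H1 (φ y)) := IsMono.of_mul (hcomp _ hH1) (hcomp _ hH2) hm2
  have hm4 : IsMono (fun y => H2 (φ y)) := IsMono.of_mul (hcomp _ hH2) (hcomp _ hH1)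
      (hm2.congr (Eventually.of_forall fun x => mul_comm _ _))
  obtain ⟨N, C, hNC⟩ := mono_local K Z hK (fun j y => f j (φ y)) (fun j y => g j (φ y))
    (fun y => h (φ y)) (fun y => π (φ y))
    (AnalyticAt.fun_comp (g := π) (by rw [hch.zero]; exact hπ) hch.an) (by
      intro j
      by_cases hj : j ∈ T
      · right
        exact IsMono.of_prod T (fun j y => f j (φ y)) (fun j _ => hcomp _ (hf j)) hm3 j hj
      · left
        have : ∀ᶠ x in 𝓝 0, f j x = 0 := by
          by_contra hcon
          exact hj (Finset.mem_filter.2 ⟨Finset.mem_univ _, hcon⟩)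
        exact hch.tendsto.eventually this)
    (fun j => IsMono.of_prod Finset.univ (fun j y => g j (φ y)) (fun j _ => hcomp _ (hg j)) hm4 j
      (Finset.mem_univ j))
    hm1 (by simp only [hch.zero]; exact hh0) (hch.tendsto.eventually hS) (hch.tendsto.eventually hZ)
  refine ⟨N, C, ?_⟩
  filter_upwards [hch.tend.eventually hNC, hch.sec, hUS] with x h1 h2 h3
  simp only [h2] at h1
  exact h1 h3
lemma ultra_sub {E : Type*} [NormedAddCommGroup E] [NormedSpace ℝ E] [FiniteDimensional ℝ E]
    {K : Set E} (hK : IsClosed K) (hKs : Subanalytic K) {h : E → ℝ} (hh : ∀ x, AnalyticAt ℝ h x)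
    (q : E) (U : Ultrafilter E) (hU : (U : Filter E) ≤ 𝓝 q)
    (hUK : ∀ᶠ x in (U : Filter E), x ∈ K) :
    ∃ (N : ℕ) (C : ℝ), ∀ᶠ x in (U : Filter E),
      Metric.infDist x {x | x ∈ K ∧ h x = 0} ^ N ≤ C * |h x| := by
  haveI := FiniteDimensional.complete ℝ E
  by_cases hq : h q = 0
  swap
  · refine ⟨0, 2 / |h q|, ?_⟩
    have h0 : 0 < |h q| := abs_pos.2 hq
    have h1 : ∀ᶠ x in 𝓝 q, |h q| / 2 < |h x| :=
      (hh q).continuousAt.abs.eventually (lt_mem_nhds (half_lt_self h0))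
    filter_upwards [h1.filter_mono hU] with x hx
    rw [pow_zero, div_mul_eq_mul_div, le_div_iff₀ h0]; linarith
  obtain ⟨O, hO, m, B, hB, hBc, hBK⟩ := hKs q
  have h1 : ∀ᶠ x in (U : Filter E), x ∈ Prod.fst '' B := by
    filter_upwards [hUK, hU hO] with x h1 h2
    have : x ∈ K ∩ O := ⟨h1, h2⟩
    rw [hBK] at this
    exact this.1
  have hex : ∀ x : E, ∃ b : E × (Fin m → ℝ), x ∈ Prod.fst '' B → b ∈ B ∧ b.1 = x := by
    intro x
    by_cases hx : x ∈ Prod.fst '' B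
    · obtain ⟨b, hb, hb1⟩ := hx
      exact ⟨b, fun _ => ⟨hb, hb1⟩⟩
    · exact ⟨(x, 0), fun h => absurd h hx⟩
  choose G hG using hex
  let W : Ultrafilter (E × (Fin m → ℝ)) := U.map G
  have hWB : ∀ᶠ x in (U : Filter E), G x ∈ B := h1.mono fun x hx => (hG x hx).1
  have hG1 : ∀ᶠ x in (U : Filter E), (G x).1 = x := h1.mono fun x hx => (hG x hx).2
  obtain ⟨b, -, hWb⟩ := hBc.ultrafilter_le_nhds W (by
    rw [le_principal_iff]
    exact hWB.mono fun x hx => subset_closure hx)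
  have hGb : Tendsto G U (𝓝 b) := hWb
  have hbq : b.1 = q := by
    have h2 : Tendsto (fun x => (G x).1) U (𝓝 b.1) := (continuous_fst.tendsto b).comp hGb
    exact tendsto_nhds_unique h2 ((tendsto_id.mono_left hU).congr' (hG1.mono fun x hx => hx.symm))
  obtain ⟨O', hO', p', q', f, g, hf, hg, hBO⟩ := hB b
  obtain ⟨i, hi⟩ : ∃ i, ∀ᶠ x in (U : Filter E), ∀ j, f i j (G x) = 0 ∧ 0 < g i j (G x) := by
    rw [← Ultrafilter.eventually_exists_iff]
    filter_upwards [hWB, hGb.eventually hO'] with x h2 h3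
    have : G x ∈ B ∩ O' := ⟨h2, h3⟩
    rw [hBO] at this
    simpa using this.1
  have hbO' : b ∈ O' := mem_of_mem_nhds hO'
  let Λ : (Fin (Module.finrank ℝ (E × (Fin m → ℝ))) → ℝ) ≃L[ℝ] (E × (Fin m → ℝ)) :=
    ContinuousLinearEquiv.ofFinrankEq (by simp)
  let A : (Fin (Module.finrank ℝ (E × (Fin m → ℝ))) → ℝ) → (E × (Fin m → ℝ)) := fun x => Λ x + b
  have hA : AnalyticAt ℝ A 0 := (Λ.analyticAt 0).add analyticAt_const
  have hA0 : A 0 = b := by simp [A]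
  have hAt : Tendsto A (𝓝 0) (𝓝 b) := by
    have := hA.continuousAt.tendsto; rwa [hA0] at this
  have hπ : AnalyticAt ℝ (fun x => (A x).1) 0 :=
    AnalyticAt.fun_comp (g := Prod.fst) ((ContinuousLinearMap.fst ℝ E (Fin m → ℝ)).analyticAt _) hA
  let S : E → (Fin (Module.finrank ℝ (E × (Fin m → ℝ))) → ℝ) := fun x => Λ.symm (G x - b)
  have hAS : ∀ x, A (S x) = G x := by intro x; simp [A, S]
  have hSt : Tendsto S U (𝓝 0) := by
    have h2 : Tendsto (fun x => G x - b) U (𝓝 0) := by simpa using hGb.sub_const b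
    have h3 := (Λ.symm.continuous.tendsto 0).comp h2
    rw [map_zero] at h3
    exact h3
  obtain ⟨N, C, hNC⟩ := ultra_local K {x | x ∈ K ∧ h x = 0} hK (fun j x => f i j (A x))
    (fun j x => g i j (A x)) (fun x => h (A x).1) (fun x => (A x).1) hπ
    (fun j => AnalyticAt.fun_comp (g := f i j) (by rw [hA0]; exact hf i j b hbO') hA)
    (fun j => AnalyticAt.fun_comp (g := g i j) (by rw [hA0]; exact hg i j b hbO') hA)
    (AnalyticAt.fun_comp (g := h) (hh _) hπ) (by simp only [hA0, hbq]; exact hq)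
    (by
      have hO2 : ∀ᶠ x in 𝓝 0, (A x).1 ∈ O := by
        have h2 : Tendsto (fun x => (A x).1) (𝓝 0) (𝓝 q) := by
          rw [← hbq]; exact (continuous_fst.tendsto b).comp hAt
        exact h2.eventually hO
      filter_upwards [hAt.eventually hO', hO2] with x h2 h3 h4
      have h5 : A x ∈ B ∩ O' := by
        rw [hBO]
        refine ⟨?_, h2⟩
        simp only [mem_iUnion, mem_iInter]
        exact ⟨i, fun j => h4 j⟩
      have h6 : (A x).1 ∈ K ∩ O := by
        rw [hBK]; exact ⟨⟨A x, h5.1, rfl⟩, h3⟩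
      exact h6.1)
    (Eventually.of_forall fun x h2 h3 => ⟨h2, h3⟩) (U.map S) hSt
    (by
      change ∀ᶠ x in (U : Filter E), ∀ j, f i j (A (S x)) = 0 ∧ 0 < g i j (A (S x))
      simpa only [hAS] using hi)
  refine ⟨N, C, ?_⟩
  have hNC' : ∀ᶠ x in (U : Filter E), Metric.infDist (A (S x)).1 {x | x ∈ K ∧ h x = 0} ^ N ≤
    C * |h (A (S x)).1| := hNC
  filter_upwards [hNC', hG1] with x h2 h3
  rwa [hAS, h3] at h2

lemma global_loj {E : Type*} [NormedAddCommGroup E] [NormedSpace ℝ E] [FiniteDimensional ℝ E]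
    {K : Set E} (hK : IsCompact K) (hKs : Subanalytic K) {h : E → ℝ} (hh : ∀ x, AnalyticAt ℝ h x) :
    ∃ (N : ℕ) (C : ℝ), 0 ≤ C ∧ ∀ x ∈ K,
      Metric.infDist x {x | x ∈ K ∧ h x = 0} ^ N ≤ C * |h x| := by
  set Z := {x | x ∈ K ∧ h x = 0}
  obtain ⟨R0, hR0⟩ := hK.exists_bound_of_continuousOn
    (Metric.continuous_infDist_pt (s := Z)).continuousOn
  set R := max R0 1
  have hR1 : 1 ≤ R := le_max_right _ _
  have hRpos : 0 < R := by linarith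
  have hR : ∀ x ∈ K, Metric.infDist x Z ≤ R := fun x hx =>
    (le_abs_self _).trans ((hR0 x hx).trans (le_max_left _ _))
  suffices hn : ∃ n : ℕ, ∀ x ∈ K, (Metric.infDist x Z / R) ^ n ≤ n * |h x| by
    obtain ⟨n, hn⟩ := hn
    refine ⟨n, R ^ n * n, by positivity, fun x hx => ?_⟩
    have := hn x hx
    rw [div_pow, div_le_iff₀ (by positivity)] at this
    linarith
  by_contra hcon
  push Not at hcon
  choose x hxK hx using hcon
  let U : Ultrafilter E := (hyperfilter ℕ).map x
  obtain ⟨q, -, hUq⟩ := hK.ultrafilter_le_nhds U (by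
    rw [le_principal_iff]
    exact Eventually.of_forall (f := (hyperfilter ℕ : Filter ℕ)) hxK)
  obtain ⟨N, C, hNC⟩ := ultra_sub hK.isClosed hKs hh q U hUq
    (Eventually.of_forall (f := (hyperfilter ℕ : Filter ℕ)) hxK)
  have hNC' : ∀ᶠ n in (hyperfilter ℕ : Filter ℕ),
    Metric.infDist (x n) Z ^ N ≤ C * |h (x n)| := hNC
  have hbig : ∀ᶠ n in (hyperfilter ℕ : Filter ℕ), N ≤ n ∧ C ≤ n := by
    have h1 : ∀ᶠ n : ℕ in atTop, N ≤ n ∧ C ≤ n :=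
      (eventually_ge_atTop N).and (tendsto_natCast_atTop_atTop.eventually_ge_atTop C)
    exact h1.filter_mono (by simpa using Nat.hyperfilter_le_atTop)
  obtain ⟨n, h1, h2, h3⟩ := (hNC'.and hbig).exists
  have h4 := hx n
  have hδ0 : 0 ≤ Metric.infDist (x n) Z / R := div_nonneg Metric.infDist_nonneg hRpos.le
  have hδ1 : Metric.infDist (x n) Z / R ≤ 1 := (div_le_one hRpos).2 (hR _ (hxK n))
  have h5 : (Metric.infDist (x n) Z / R) ^ n ≤ (Metric.infDist (x n) Z / R) ^ N :=
    pow_le_pow_of_le_one hδ0 hδ1 h2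
  have h6 : (Metric.infDist (x n) Z / R) ^ N ≤ Metric.infDist (x n) Z ^ N :=
    pow_le_pow_left₀ hδ0 (div_le_self Metric.infDist_nonneg hR1) N
  have h7 : C * |h (x n)| ≤ n * |h (x n)| := mul_le_mul_of_nonneg_right h3 (abs_nonneg _)
  linarith

lemma analytic_evalQ {n : ℕ} (Q : MvPolynomial (Fin n) ℂ) (x : EuclideanSpace ℂ (Fin n)) :
    AnalyticAt ℝ (fun x : EuclideanSpace ℂ (Fin n) => MvPolynomial.eval (fun i => x i) Q) x := by
  induction Q using MvPolynomial.induction_on with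
  | C a => simpa using analyticAt_const
  | add p q hp hq => 
    simp only [map_add]
    exact hp.add hq
  | mul_X p i hp =>
    have h1 : AnalyticAt ℝ (fun x : EuclideanSpace ℂ (Fin n) => x i) x :=
      ((EuclideanSpace.proj (𝕜 := ℂ) i).restrictScalars ℝ).analyticAt x
    simp only [map_mul, MvPolynomial.eval_X]
    exact hp.mul h1

theorem rational_hasPolyGrowthAt {n : ℕ} (P Q : MvPolynomial (Fin n) ℂ) (hQ : Q ≠ 0)
    (K : Set (EuclideanSpace ℂ (Fin n))) (hK : IsCompact K) (hKs : Subanalytic K)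
    (p : EuclideanSpace ℂ (Fin n)) (hp : p ∈ K) :
    ∃ K' ⊆ K, IsCompact K' ∧ K' ∈ nhdsWithin p K ∧ ∃ C > (0 : ℝ), ∃ N : ℕ,
      ∀ x ∈ K', MvPolynomial.eval (fun i => x i) Q ≠ 0 →
        Metric.infDist x (K' \ {y | MvPolynomial.eval (fun i => y i) Q ≠ 0}) ^ N *
          ‖MvPolynomial.eval (fun i => x i) P / MvPolynomial.eval (fun i => x i) Q‖ ≤ C := by
  let h : EuclideanSpace ℂ (Fin n) → ℝ := fun x =>
    Complex.normSq (MvPolynomial.eval (fun i => x i) Q)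
  have hh : ∀ x, AnalyticAt ℝ h x := by
    intro x
    have h1 : AnalyticAt ℝ (fun x : EuclideanSpace ℂ (Fin n) =>
        (MvPolynomial.eval (fun i => x i) Q).re) x :=
      AnalyticAt.fun_comp (g := Complex.re) (Complex.reCLM.analyticAt _) (analytic_evalQ Q x)
    have h2 : AnalyticAt ℝ (fun x : EuclideanSpace ℂ (Fin n) =>
        (MvPolynomial.eval (fun i => x i) Q).im) x :=
      AnalyticAt.fun_comp (g := Complex.im) (Complex.imCLM.analyticAt _) (analytic_evalQ Q x)
    simp only [h, Complex.normSq_apply]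
    exact (h1.mul h1).add (h2.mul h2)
  haveI : FiniteDimensional ℝ (EuclideanSpace ℂ (Fin n)) := FiniteDimensional.complexToReal _
  obtain ⟨N, C, hC, hNC⟩ := global_loj hK hKs hh
  obtain ⟨S, hS⟩ := hK.exists_bound_of_continuousOn
    (fun x _ => (analytic_evalQ Q x).continuousAt.continuousWithinAt)
  obtain ⟨T, hT⟩ := hK.exists_bound_of_continuousOn
    (fun x _ => (analytic_evalQ P x).continuousAt.continuousWithinAt)
  have hS0 : 0 ≤ S := (norm_nonneg _).trans (hS p hp)
  have hT0 : 0 ≤ T := (norm_nonneg _).trans (hT p hp)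
  refine ⟨K, Subset.rfl, hK, self_mem_nhdsWithin, C * S * T + 1, by positivity, N, ?_⟩
  intro x hx hxQ
  have hZ : K \ {y | MvPolynomial.eval (fun i => y i) Q ≠ 0} = {x | x ∈ K ∧ h x = 0} := by
    ext y; simp [h]
  rw [hZ]
  have h1 := hNC x hx
  have hq : 0 < ‖MvPolynomial.eval (fun i => x i) Q‖ := norm_pos_iff.2 hxQ
  have h2 : |h x| = ‖MvPolynomial.eval (fun i => x i) Q‖ * ‖MvPolynomial.eval (fun i => x i) Q‖ := by
    simp only [h]
    rw [abs_of_nonneg (Complex.normSq_nonneg _), Complex.normSq_eq_norm_sq]; ring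
  rw [norm_div, mul_div_assoc', div_le_iff₀ hq]
  calc _ ≤ (C * |h x|) * T := by
        refine mul_le_mul h1 (hT x hx) (norm_nonneg _) (by positivity)
    _ = (C * T) * ‖MvPolynomial.eval (fun i => x i) Q‖ * ‖MvPolynomial.eval (fun i => x i) Q‖ := by
        rw [h2]; ring
    _ ≤ (C * T) * S * ‖MvPolynomial.eval (fun i => x i) Q‖ := by
        have := hS x hx
        gcongr
    _ ≤ _ := by nlinarith
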